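/- If Q is a finite quiver without loops which is not of Dynkin type, then there are infinitely many rigid bricks in the category P(Q)-nil of finite-dimensional nilpotent modules over the preprojective algebra P(Q). -/

import Mathlib

open CategoryTheory Limits Pretriangulated

universe v u

namespace GreenSeqPaper



/-- A finite quiver without loops: finitely many vertices `V` and arrows `A`,
with source and target maps, and no arrow from a vertex to itself. -/
structure LooplessQuiver where
  V : Type
  A : Type
  [fintypeV : Fintype V]
  [decEqV : DecidableEq V]
  [fintypeA : Fintype A]
  src : A → V
  tgt : A → V
  no_loops : ∀ a, src a ≠ tgt a

attribute [instance] LooplessQuiver.fintypeV LooplessQuiver.decEqV LooplessQuiver.fintypeA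

namespace LooplessQuiver

variable (Q : LooplessQuiver)

/-- The arrows of the double quiver `Q̄`: an arrow `a : i ⟶ j` of `Q` (left) together
with a reversed arrow `a* : j ⟶ i` (right). -/
abbrev DArrow := Q.A ⊕ Q.A

/-- Source of an arrow of the double quiver. -/
def dsrc : Q.DArrow → Q.V
  | .inl a => Q.src a
  | .inr a => Q.tgt a

/-- Target of an arrow of the double quiver. -/
def dtgt : Q.DArrow → Q.V
  | .inl a => Q.tgt a
  | .inr a => Q.src a

/-- Generators of the path algebra of the double quiver: one idempotent `e i` for each
vertex `i` and one generator `x a` for each arrow `a` of the double quiver. -/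
abbrev Gen := Q.V ⊕ Q.DArrow

/-- The vertex idempotent `e i` in the free algebra. -/
noncomputable def e (i : Q.V) : FreeAlgebra ℂ Q.Gen := FreeAlgebra.ι ℂ (Sum.inl i)

/-- The arrow generator `x a` in the free algebra. -/
noncomputable def x (a : Q.DArrow) : FreeAlgebra ℂ Q.Gen := FreeAlgebra.ι ℂ (Sum.inr a)

/-- The relations presenting the preprojective algebra `P(Q) = ℂQ̄/(c)`:
the path-algebra relations of the double quiver `Q̄` (orthogonal vertex idempotents
summing to `1`, compatibility of arrows with their endpoints), together with the
preprojective relation `c = Σ_{a ∈ Q₁} (a a* - a* a) = 0`. -/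
inductive Rel : FreeAlgebra ℂ Q.Gen → FreeAlgebra ℂ Q.Gen → Prop
  | vertex_mul (i j : Q.V) : Rel (Q.e i * Q.e j) (if i = j then Q.e i else 0)
  | vertex_sum : Rel (∑ i : Q.V, Q.e i) 1
  | arrow_left (a : Q.DArrow) : Rel (Q.e (Q.dtgt a) * Q.x a) (Q.x a)
  | arrow_right (a : Q.DArrow) : Rel (Q.x a * Q.e (Q.dsrc a)) (Q.x a)
  | preprojective :
      Rel (∑ a : Q.A, (Q.x (Sum.inl a) * Q.x (Sum.inr a) - Q.x (Sum.inr a) * Q.x (Sum.inl a))) 0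

/-- The preprojective algebra `P(Q)` of the quiver `Q`. -/
abbrev Preproj := RingQuot Q.Rel

/-- The image of the vertex idempotent `e i` in `P(Q)`. -/
noncomputable def pe (i : Q.V) : Q.Preproj := RingQuot.mkAlgHom ℂ Q.Rel (Q.e i)

/-- The image of the arrow generator `x a` in `P(Q)`. -/
noncomputable def px (a : Q.DArrow) : Q.Preproj := RingQuot.mkAlgHom ℂ Q.Rel (Q.x a)

/-- The symmetric bilinear form `(x, y) = 2 Σ_i x_i y_i - Σ_{a : i → j ∈ Q̄₁} x_i y_j`
on the root lattice `ℤQ₀` (the sum runs over the arrows of the double quiver). -/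
def form (v w : Q.V → ℤ) : ℤ :=
  2 * ∑ i : Q.V, v i * w i -
    ∑ a : Q.A, (v (Q.src a) * w (Q.tgt a) + v (Q.tgt a) * w (Q.src a))

/-- `Q` is of Dynkin type, i.e. its underlying graph is a disjoint union of ADE Dynkin
diagrams; equivalently, the symmetric bilinear form of `Q` is positive definite. -/
def IsDynkin : Prop := ∀ v : Q.V → ℤ, v ≠ 0 → 0 < Q.form v v

end LooplessQuiver

section Modules

open ModuleCat

variable (Q : LooplessQuiver)

-- the scoped instances `ModuleCat.moduleOfAlgebraModule` and
-- `ModuleCat.isScalarTower_of_algebra_moduleCat` give each `P(Q)`-module its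
-- canonical `ℂ`-vector space structure
attribute [local instance] ModuleCat.moduleOfAlgebraModule
  ModuleCat.isScalarTower_of_algebra_moduleCat

/-- A `P(Q)`-module is finite-dimensional if it is so as a `ℂ`-vector space. -/
def LooplessQuiver.FinDim (M : ModuleCat.{0} Q.Preproj) : Prop := FiniteDimensional ℂ M

/-- A `P(Q)`-module is nilpotent if all sufficiently long products of arrows act by zero;
equivalently, all its composition factors are the vertex simples `S₁, …, Sₙ`. -/
def LooplessQuiver.IsNilpotentMod (M : ModuleCat.{0} Q.Preproj) : Prop :=
  ∃ N : ℕ, ∀ l : List Q.DArrow, l.length = N → ∀ m : M, (l.map Q.px).prod • m = 0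

/-- The dimension of the vector space `eᵢ M` attached to the vertex `i` by the
`P(Q)`-module `M` (viewed as a representation of the double quiver). -/
noncomputable def LooplessQuiver.dimAt (M : ModuleCat.{0} Q.Preproj) (i : Q.V) : ℕ :=
  Module.finrank ℂ (Submodule.span ℂ (Set.range fun m : M => Q.pe i • m))

/-- The dimension vector of a `P(Q)`-module, as an element of the root lattice `ℤQ₀`. -/
noncomputable def LooplessQuiver.dimVec (M : ModuleCat.{0} Q.Preproj) : Q.V → ℤ :=
  fun i => (Q.dimAt M i : ℤ)

/-- A brick: a module `M` with `Hom(M, M) = ℂ`, i.e. `M` is nonzero and every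
endomorphism of `M` is multiplication by a scalar. -/
def LooplessQuiver.IsBrick (M : ModuleCat.{0} Q.Preproj) : Prop :=
  (∃ m : M, m ≠ 0) ∧
    ∀ f : M ⟶ M, ∃ c : ℂ, ∀ m : M, f m = algebraMap ℂ Q.Preproj c • m

/-- `Ext¹(M, N) = 0` for `P(Q)`-modules. -/
def LooplessQuiver.Ext1Vanishes (M N : ModuleCat.{0} Q.Preproj) : Prop :=
  Subsingleton (((Ext ℂ (ModuleCat.{0} Q.Preproj) 1).obj (Opposite.op M)).obj N)

/-- A module is rigid if `Ext¹(M, M) = 0`. -/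
def LooplessQuiver.IsRigid (M : ModuleCat.{0} Q.Preproj) : Prop := Q.Ext1Vanishes M M

/-- `dim_ℂ Extⁿ(M, N)` for `P(Q)`-modules. -/
noncomputable def LooplessQuiver.extDim (n : ℕ) (M N : ModuleCat.{0} Q.Preproj) : ℕ :=
  Module.finrank ℂ (((Ext ℂ (ModuleCat.{0} Q.Preproj) n).obj (Opposite.op M)).obj N)

/-- `dim_ℂ Hom(M, N)` for `P(Q)`-modules. -/
noncomputable def LooplessQuiver.homDim (M N : ModuleCat.{0} Q.Preproj) : ℕ :=
  Module.finrank ℂ (M ⟶ N)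

end Modules


namespace LooplessQuiver

variable (Q : LooplessQuiver)

theorem form_comm (v w : Q.V → ℤ) : Q.form v w = Q.form w v := by
  simp only [form]
  congr 1
  · simp only [mul_comm]
  · exact Finset.sum_congr rfl fun a _ => by ring

theorem form_single (v : Q.V → ℤ) (j : Q.V) :
    Q.form v (Pi.single j 1) = 2 * v j -
      ∑ a : Q.A, ((if Q.tgt a = j then v (Q.src a) else 0) +
        (if Q.src a = j then v (Q.tgt a) else 0)) := by
  simp [form, Pi.single_apply]

theorem form_eq_sum (v w : Q.V → ℤ) :
    Q.form v w = ∑ j, w j * Q.form v (Pi.single j 1) := by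
  simp only [form_single, mul_sub, Finset.sum_sub_distrib, Finset.mul_sum, mul_add, mul_ite,
    mul_zero]
  rw [Finset.sum_comm (s := Finset.univ (α := Q.V))]
  simp only [form, Finset.sum_add_distrib, Finset.sum_ite_eq, Finset.mem_univ, if_true,
    Finset.mul_sum]
  congr 1
  · exact Finset.sum_congr rfl fun a _ => by ring
  · congr 1 <;> exact Finset.sum_congr rfl fun a _ => by ring

theorem form_single_self (i : Q.V) : Q.form (Pi.single i 1) (Pi.single i 1) = 2 := by
  rw [form_single, Finset.sum_eq_zero, Pi.single_eq_same]
  · norm_num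
  · intro a _
    have := Q.no_loops a
    rcases eq_or_ne (Q.tgt a) i with h | h <;> rcases eq_or_ne (Q.src a) i with h' | h' <;>
      simp_all

theorem form_sub_left (u v w : Q.V → ℤ) : Q.form (u - v) w = Q.form u w - Q.form v w := by
  rw [form_comm, form_eq_sum, form_comm Q u, form_eq_sum Q w u, form_comm Q v, form_eq_sum Q w v,
    ← Finset.sum_sub_distrib]
  exact Finset.sum_congr rfl fun j _ => by simp [sub_mul]

theorem form_smul_left (c : ℤ) (v w : Q.V → ℤ) : Q.form (c • v) w = c * Q.form v w := by
  rw [form_comm, form_eq_sum, form_comm Q v, form_eq_sum Q w v, Finset.mul_sum]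
  exact Finset.sum_congr rfl fun j _ => by simp [mul_assoc]

theorem form_sum_left {ι : Type*} (s : Finset ι) (v : ι → Q.V → ℤ) (w : Q.V → ℤ) :
    Q.form (∑ k ∈ s, v k) w = ∑ k ∈ s, Q.form (v k) w := by
  rw [form_comm, form_eq_sum, Finset.sum_congr rfl fun k _ => (form_comm Q (v k) w).trans
    (form_eq_sum Q w (v k)), Finset.sum_comm]
  exact Finset.sum_congr rfl fun j _ => by rw [Finset.sum_apply, Finset.sum_mul]

/-- The simple reflection `s_i` on the root lattice. -/
def reflection (i : Q.V) (v : Q.V → ℤ) : Q.V → ℤ :=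
  v - Q.form v (Pi.single i 1) • Pi.single i 1

theorem form_reflection_self (i : Q.V) (v : Q.V → ℤ) :
    Q.form (Q.reflection i v) (Q.reflection i v) = Q.form v v := by
  have h := form_single_self Q i
  set α : Q.V → ℤ := Pi.single i 1
  have h1 : ∀ w, Q.form (Q.reflection i v) w = Q.form v w - Q.form v α * Q.form α w := fun w => by
    rw [reflection, form_sub_left, form_smul_left]
  rw [h1, form_comm Q v, form_comm Q α, h1, h1, h, form_comm Q α v]
  ring

variable {Q}

/-- A set of vectors of finite cardinality which is closed under simple reflections (as far as
nonnegativity permits) contains, for every vertex `i` of `S`, a vector supported on `S`, nonzero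
at `i` and dominant on `S`. -/
theorem exists_dominant {D : Set (Q.V → ℤ)} (hfin : D.Finite)
    (hsimple : ∀ i, Pi.single i 1 ∈ D)
    (hrefl : ∀ d ∈ D, ∀ i, d ≠ Pi.single i 1 → Q.reflection i d ∈ D)
    (S : Set Q.V) {i : Q.V} (hi : i ∈ S) :
    ∃ β ∈ D, 0 < β i ∧ (∀ j ∉ S, β j = 0) ∧ ∀ j ∈ S, 0 ≤ Q.form β (Pi.single j 1) := by
  let E : Set (Q.V → ℤ) := {β | β ∈ D ∧ 0 < β i ∧ ∀ j ∉ S, β j = 0}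
  have hE : E.Finite := hfin.subset fun β h => h.1
  have hne : E.Nonempty := by
    refine ⟨Pi.single i 1, hsimple i, by simp, fun j hj => ?_⟩
    exact Pi.single_eq_of_ne (by rintro rfl; exact hj hi) _
  obtain ⟨β, ⟨hβD, hβi, hβS⟩, hmax⟩ := Set.exists_max_image E (fun β => ∑ j, β j) hE hne
  refine ⟨β, hβD, hβi, hβS, fun j hj => ?_⟩
  by_contra! hlt
  have hne : β ≠ Pi.single j 1 := by
    rintro rfl
    rw [form_single_self] at hlt
    omega
  have hmem : Q.reflection j β ∈ E := by
    refine ⟨hrefl β hβD j hne, ?_, fun k hk => ?_⟩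
    · rcases eq_or_ne i j with rfl | hij
      · simp [reflection]; omega
      · simpa [reflection, hij] using hβi
    · have : k ≠ j := by rintro rfl; exact hk hj
      simpa [reflection, this] using hβS k hk
  have hle := hmax _ hmem
  have hs : ∑ k, Q.reflection j β k = ∑ k, β k - Q.form β (Pi.single j 1) := by
    simp [reflection, Finset.sum_sub_distrib, ← Finset.mul_sum]
  simp only [hs] at hle
  omega

theorem form_eq_sum_squares (b v : Q.V → ℤ) (t : Q.V → ℚ) (hv : ∀ j, (v j : ℚ) = t j * b j) :
    (Q.form v v : ℚ) = ∑ j, Q.form b (Pi.single j 1) * b j * t j ^ 2 +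
      ∑ a, b (Q.src a) * b (Q.tgt a) * (t (Q.src a) - t (Q.tgt a)) ^ 2 := by
  have h : ∑ j, (Q.form b (Pi.single j 1) : ℚ) * b j * t j ^ 2 =
      2 * ∑ j, (b j * t j) ^ 2 - ∑ a, (b (Q.src a) * b (Q.tgt a) * t (Q.tgt a) ^ 2 +
        b (Q.tgt a) * b (Q.src a) * t (Q.src a) ^ 2 : ℚ) := by
    simp only [form_single]
    push_cast
    simp only [sub_mul, Finset.sum_sub_distrib, Finset.sum_mul, add_mul, ite_mul, zero_mul]
    rw [Finset.sum_comm (s := Finset.univ (α := Q.V))]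
    simp only [Finset.sum_add_distrib, Finset.sum_ite_eq, Finset.mem_univ, if_true,
      Finset.mul_sum]
    congr 1
    exact Finset.sum_congr rfl fun a _ => by ring
  rw [h, form]
  push_cast
  simp only [hv]
  rw [sub_add, ← Finset.sum_sub_distrib]
  congr 1
  · congr 1
    exact Finset.sum_congr rfl fun a _ => by ring
  · exact Finset.sum_congr rfl fun a _ => by ring

theorem isDynkin_of_finite {D : Set (Q.V → ℤ)} (hfin : D.Finite) (hpos : ∀ d ∈ D, ∀ j, 0 ≤ d j)
    (hform : ∀ d ∈ D, Q.form d d = 2) (hsimple : ∀ i, Pi.single i 1 ∈ D)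
    (hrefl : ∀ d ∈ D, ∀ i, d ≠ Pi.single i 1 → Q.reflection i d ∈ D) : Q.IsDynkin := by
  intro v hv
  by_contra! hle
  choose β hβD hβi _ hβ using fun i =>
    exists_dominant hfin hsimple hrefl Set.univ (Set.mem_univ i)
  set b : Q.V → ℤ := ∑ i, β i with hb
  have hbpos : ∀ j, 0 < b j := fun j => by
    rw [hb, Finset.sum_apply]
    exact Finset.sum_pos' (fun i _ => hpos _ (hβD i) j) ⟨j, Finset.mem_univ _, hβi j⟩
  have hbdom : ∀ j, 0 ≤ Q.form b (Pi.single j 1) := fun j => by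
    rw [hb, form_sum_left]
    exact Finset.sum_nonneg fun i _ => hβ i j (Set.mem_univ j)
  have hbpos' : ∀ j, (0 : ℚ) < b j := fun j => by exact_mod_cast hbpos j
  have hbdom' : ∀ j, (0 : ℚ) ≤ Q.form b (Pi.single j 1) := fun j => by exact_mod_cast hbdom j
  let t : Q.V → ℚ := fun j => v j / b j
  have ht : ∀ j, (v j : ℚ) = t j * b j := fun j => (div_mul_cancel₀ _ (hbpos' j).ne').symm
  have key := form_eq_sum_squares b v t ht
  have hle' : (Q.form v v : ℚ) ≤ 0 := by exact_mod_cast hle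
  have h1 : ∀ j ∈ Finset.univ, (0 : ℚ) ≤ Q.form b (Pi.single j 1) * b j * t j ^ 2 := fun j _ =>
    mul_nonneg (mul_nonneg (hbdom' j) (hbpos' j).le) (sq_nonneg _)
  have h2 : ∀ a ∈ Finset.univ,
      (0 : ℚ) ≤ b (Q.src a) * b (Q.tgt a) * (t (Q.src a) - t (Q.tgt a)) ^ 2 := fun a _ =>
    mul_nonneg (mul_nonneg (hbpos' _).le (hbpos' _).le) (sq_nonneg _)
  have h1s := Finset.sum_nonneg h1
  have h2s := Finset.sum_nonneg h2
  have hrad : ∀ j, t j ≠ 0 → Q.form b (Pi.single j 1) = 0 := fun j hj => by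
    have := (Finset.sum_eq_zero_iff_of_nonneg h1).1 (by linarith) j (Finset.mem_univ j)
    simpa [hj, (hbpos j).ne'] using this
  have hconst : ∀ a, t (Q.src a) = t (Q.tgt a) := fun a => by
    have := (Finset.sum_eq_zero_iff_of_nonneg h2).1 (by linarith) a (Finset.mem_univ a)
    simpa [(hbpos _).ne', sub_eq_zero] using this
  obtain ⟨i, hi⟩ := Function.ne_iff.1 hv
  have hti : t i ≠ 0 := by
    intro h
    have := ht i
    rw [h, zero_mul] at this
    exact hi (by exact_mod_cast this)
  obtain ⟨γ, hγD, -, hγS, hγ⟩ :=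
    exists_dominant hfin hsimple hrefl {j | t j ≠ 0} (i := i) hti
  classical
  let δ : Q.V → ℤ := fun j => if t j = 0 then 0 else b j
  have hδ : Q.form γ δ = 0 := by
    rw [form_comm, form_eq_sum]
    refine Finset.sum_eq_zero fun k _ => ?_
    by_cases hk : t k = 0
    · rw [hγS k (by simpa using hk), zero_mul]
    · have : Q.form δ (Pi.single k 1) = Q.form b (Pi.single k 1) := by
        simp only [form_single, δ, if_neg hk]
        congr 1
        refine Finset.sum_congr rfl fun a _ => ?_
        have hc := hconst a
        by_cases h3 : Q.tgt a = k <;> by_cases h4 : Q.src a = k <;> simp_all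
      rw [this, hrad k hk, mul_zero]
  rw [form_eq_sum] at hδ
  have hnn : ∀ j ∈ Finset.univ, 0 ≤ δ j * Q.form γ (Pi.single j 1) := fun j _ => by
    by_cases hj : t j = 0
    · simp [δ, hj]
    · simpa [δ, hj] using mul_nonneg (hbpos j).le (hγ j hj)
  have hzero := (Finset.sum_eq_zero_iff_of_nonneg hnn).1 hδ
  have h2' := hform γ hγD
  rw [form_eq_sum, Finset.sum_eq_zero] at h2'
  · omega
  · intro j _
    by_cases hj : t j = 0
    · rw [hγS j (by simpa using hj), zero_mul]
    · have := hzero j (Finset.mem_univ j)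
      simp only [δ, if_neg hj, mul_eq_zero, (hbpos j).ne', false_or] at this
      rw [this, mul_zero]

end LooplessQuiver

namespace LooplessQuiver

variable (Q : LooplessQuiver)

theorem dsrc_swap (a : Q.DArrow) : Q.dsrc a.swap = Q.dtgt a := by
  cases a <;> rfl

theorem dtgt_swap (a : Q.DArrow) : Q.dtgt a.swap = Q.dsrc a := by
  cases a <;> rfl

theorem dsrc_ne_dtgt (a : Q.DArrow) : Q.dsrc a ≠ Q.dtgt a := by
  cases a with
  | inl a => exact Q.no_loops a
  | inr a => exact (Q.no_loops a).symm

/-- The sign with which `a a*` occurs in the preprojective relation. -/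
def sign : Q.DArrow → ℂ
  | .inl _ => 1
  | .inr _ => -1

theorem sign_mul_self (a : Q.DArrow) : Q.sign a * Q.sign a = 1 := by
  cases a <;> simp [sign]

/-- A representation of `P(Q)` on `T` by operators, where the vertex idempotents are not required
to sum to the identity; the underlying module is the image of their sum. -/
structure OpRep (T : Type) [AddCommGroup T] [Module ℂ T] where
  e : Q.V → Module.End ℂ T
  x : Q.DArrow → Module.End ℂ T
  e_mul : ∀ i j, e i * e j = if i = j then e i else 0
  e_tgt_mul : ∀ a, e (Q.dtgt a) * x a = x a
  mul_e_src : ∀ a, x a * e (Q.dsrc a) = x a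
  rel : ∑ a : Q.DArrow, Q.sign a • (x a * x a.swap) = 0

variable {Q}

namespace OpRep

variable {T : Type} [AddCommGroup T] [Module ℂ T] (r : Q.OpRep T)

theorem e_e_apply (i j : Q.V) (t : T) : r.e i (r.e j t) = if i = j then r.e i t else 0 := by
  rw [← Module.End.mul_apply, r.e_mul]
  split_ifs <;> rfl

theorem e_mul_x (i : Q.V) (a : Q.DArrow) : r.e i * r.x a = if i = Q.dtgt a then r.x a else 0 := by
  rw [← r.e_tgt_mul a, ← mul_assoc, r.e_mul]
  split_ifs with h
  · rw [h]
  · rw [zero_mul]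

theorem x_mul_e (i : Q.V) (a : Q.DArrow) : r.x a * r.e i = if i = Q.dsrc a then r.x a else 0 := by
  rw [← r.mul_e_src a, mul_assoc, r.e_mul]
  rcases eq_or_ne i (Q.dsrc a) with h | h
  · simp [h]
  · simp [h, h.symm]

theorem e_x_apply (i : Q.V) (a : Q.DArrow) (t : T) :
    r.e i (r.x a t) = if i = Q.dtgt a then r.x a t else 0 := by
  rw [← Module.End.mul_apply, r.e_mul_x]
  split_ifs <;> rfl

theorem x_e_apply (i : Q.V) (a : Q.DArrow) (t : T) :
    r.x a (r.e i t) = if i = Q.dsrc a then r.x a t else 0 := by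
  rw [← Module.End.mul_apply, r.x_mul_e]
  split_ifs <;> rfl

theorem rel_apply (t : T) : ∑ a : Q.DArrow, Q.sign a • r.x a (r.x a.swap t) = 0 := by
  simpa using LinearMap.congr_fun r.rel t

/-- The projection onto the underlying module. -/
def unit : Module.End ℂ T := ∑ i, r.e i

theorem e_mul_unit (i : Q.V) : r.e i * r.unit = r.e i := by
  simp [unit, Finset.mul_sum, r.e_mul]

theorem unit_mul_e (i : Q.V) : r.unit * r.e i = r.e i := by
  simp [unit, Finset.sum_mul, r.e_mul]

theorem unit_mul_unit : r.unit * r.unit = r.unit := by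
  conv_lhs => enter [1]; rw [unit]
  simp only [Finset.sum_mul, e_mul_unit]
  rfl

theorem x_mul_unit (a : Q.DArrow) : r.x a * r.unit = r.x a := by
  simp [unit, Finset.mul_sum, r.x_mul_e]

theorem unit_mul_x (a : Q.DArrow) : r.unit * r.x a = r.x a := by
  simp [unit, Finset.sum_mul, r.e_mul_x]

/-- Every endomorphism of the underlying module is a scalar. -/
def IsBrick : Prop :=
  ∀ f : Module.End ℂ T, (∀ i, f * r.e i = r.e i * f) → (∀ a, f * r.x a = r.x a * f) →
    ∃ c : ℂ, f * r.unit = c • r.unit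

/-- The span of the images of all paths of length `n`. -/
def pathImage : ℕ → Submodule ℂ T
  | 0 => ⊤
  | n + 1 => ⨆ a, (pathImage n).map (r.x a)

/-- All sufficiently long paths act by zero. -/
def IsNil : Prop := ∃ N, r.pathImage N = ⊥

/-- The dimension vector of the underlying module is `d`. -/
def HasDim (d : Q.V → ℤ) : Prop := ∀ j, LinearMap.trace ℂ T (r.e j) = d j

theorem x_mem_pathImage (a : Q.DArrow) {n : ℕ} {t : T} (ht : t ∈ r.pathImage n) :
    r.x a t ∈ r.pathImage (n + 1) :=
  Submodule.mem_iSup_of_mem a (Submodule.mem_map_of_mem ht)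

section Reflection

variable (i : Q.V)

/-- The sum `⊕ M_j → M_i` of the signed arrows into `i`. -/
def inMap : (Q.DArrow → T) →ₗ[ℂ] T :=
  ∑ a, if Q.dtgt a = i then Q.sign a • r.x a ∘ₗ LinearMap.proj a else 0

/-- The product `M_i → ⊕ M_j` of the arrows out of `i`. -/
def outMap : T →ₗ[ℂ] (Q.DArrow → T) :=
  LinearMap.pi fun a => if Q.dtgt a = i then r.x a.swap else 0

/-- The projection of the space of all families of vectors indexed by arrows onto `⊕ M_j`, where
the sum runs over the arrows `j ⟶ i`. -/
def nbrProj : Module.End ℂ (Q.DArrow → T) :=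
  LinearMap.pi fun a => if Q.dtgt a = i then r.e (Q.dsrc a) ∘ₗ LinearMap.proj a else 0

theorem inMap_apply (w : Q.DArrow → T) :
    r.inMap i w = ∑ a, if Q.dtgt a = i then Q.sign a • r.x a (w a) else 0 := by
  simp only [inMap, LinearMap.sum_apply]
  exact Finset.sum_congr rfl fun a _ => by split_ifs <;> rfl

theorem outMap_apply (t : T) (a : Q.DArrow) :
    r.outMap i t a = if Q.dtgt a = i then r.x a.swap t else 0 := by
  simp only [outMap, LinearMap.pi_apply]
  split_ifs <;> rfl

theorem nbrProj_apply (w : Q.DArrow → T) (a : Q.DArrow) :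
    r.nbrProj i w a = if Q.dtgt a = i then r.e (Q.dsrc a) (w a) else 0 := by
  simp only [nbrProj, LinearMap.pi_apply]
  split_ifs <;> rfl

theorem inMap_single (a : Q.DArrow) (t : T) [DecidableEq Q.DArrow] :
    r.inMap i (Pi.single a t) = if Q.dtgt a = i then Q.sign a • r.x a t else 0 := by
  rw [inMap_apply, Finset.sum_eq_single a]
  · simp
  · intro b _ hb
    simp [Pi.single_eq_of_ne hb]
  · simp

theorem inMap_nbrProj (w : Q.DArrow → T) : r.inMap i (r.nbrProj i w) = r.inMap i w := by
  simp only [inMap_apply, nbrProj_apply]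
  refine Finset.sum_congr rfl fun a _ => ?_
  split_ifs <;> simp [x_e_apply]

theorem nbrProj_outMap (t : T) : r.nbrProj i (r.outMap i t) = r.outMap i t := by
  ext a
  simp only [outMap_apply, nbrProj_apply]
  split_ifs <;> simp [e_x_apply, dtgt_swap]

theorem nbrProj_nbrProj (w : Q.DArrow → T) :
    r.nbrProj i (r.nbrProj i w) = r.nbrProj i w := by
  ext a
  simp only [nbrProj_apply]
  split_ifs <;> simp [e_e_apply]

theorem inMap_outMap (t : T) : r.inMap i (r.outMap i t) = 0 := by
  have h := congrArg (r.e i) (r.rel_apply t)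
  rw [map_sum, map_zero] at h
  rw [← h, inMap_apply]
  refine Finset.sum_congr rfl fun a _ => ?_
  simp only [outMap_apply, map_smul, e_x_apply, eq_comm (a := i)]
  split_ifs <;> simp

theorem e_inMap (w : Q.DArrow → T) : r.e i (r.inMap i w) = r.inMap i w := by
  simp only [inMap_apply, map_sum]
  refine Finset.sum_congr rfl fun a _ => ?_
  split_ifs with h <;> simp [e_x_apply, h]

theorem outMap_e (t : T) : r.outMap i (r.e i t) = r.outMap i t := by
  ext a
  simp only [outMap_apply, x_e_apply, dsrc_swap]
  split_ifs with h h'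
  · rfl
  · exact absurd h.symm h'
  · rfl

theorem nbrProj_single (a : Q.DArrow) (t : T) [DecidableEq Q.DArrow] :
    r.nbrProj i (Pi.single a t) =
      if Q.dtgt a = i then Pi.single a (r.e (Q.dsrc a) t) else 0 := by
  ext b
  rw [nbrProj_apply]
  rcases eq_or_ne b a with rfl | hb
  · split_ifs <;> simp
  · split_ifs <;> simp [Pi.single_eq_of_ne hb]

/-- A replacement of the vertex space `M_i` by the image of the idempotent `q`, together with new
arrows `ψ` into and `φ` out of that space, having the same composite `⊕ M_j → ⊕ M_j`. -/
structure Replacement where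
  q : Module.End ℂ (Q.DArrow → T)
  ψ : Module.End ℂ (Q.DArrow → T)
  φ : Module.End ℂ (Q.DArrow → T)
  q_q : ∀ w, q (q w) = q w
  q_ψ : ∀ w, q (ψ w) = ψ w
  ψ_nbrProj : ∀ w, ψ (r.nbrProj i w) = ψ w
  φ_q : ∀ w, φ (q w) = φ w
  nbrProj_φ : ∀ w, r.nbrProj i (φ w) = φ w
  ψ_φ : ∀ w, ψ (φ w) = 0
  φ_ψ : ∀ w, φ (ψ w) = r.outMap i (r.inMap i w)

variable {r i}

namespace Replacement

variable (m : r.Replacement i)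

theorem φ_apply_of_ne {a : Q.DArrow} (ha : Q.dtgt a ≠ i) (w : Q.DArrow → T) : m.φ w a = 0 := by
  rw [← m.nbrProj_φ, nbrProj_apply, if_neg ha]

theorem ψ_single_of_ne [DecidableEq Q.DArrow] {a : Q.DArrow} (ha : Q.dtgt a ≠ i) (t : T) :
    m.ψ (Pi.single a t) = 0 := by
  rw [← m.ψ_nbrProj, nbrProj_single, if_neg ha, map_zero]

variable (r i) in
/-- The arrows which do not touch the vertex `i`. -/
def awayArrow (a : Q.DArrow) : Module.End ℂ T :=
  if Q.dsrc a = i ∨ Q.dtgt a = i then 0 else r.x a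

open Classical in
/-- The arrow operators of the replaced representation. -/
noncomputable def arrow (a : Q.DArrow) : Module.End ℂ (T × (Q.DArrow → T)) :=
  LinearMap.prod
    ((awayArrow r i a) ∘ₗ LinearMap.fst ℂ T _ +
      LinearMap.proj a.swap ∘ₗ m.φ ∘ₗ LinearMap.snd ℂ T _)
    (Q.sign a • m.ψ ∘ₗ LinearMap.single ℂ (fun _ => T) a ∘ₗ LinearMap.fst ℂ T _)

open Classical in
theorem arrow_apply (a : Q.DArrow) (t : T) (w : Q.DArrow → T) :
    m.arrow a (t, w) =
      (awayArrow r i a t + m.φ w a.swap, Q.sign a • m.ψ (Pi.single a t)) := rfl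

/-- The vertex idempotents of the replaced representation. -/
def idem (j : Q.V) : Module.End ℂ (T × (Q.DArrow → T)) :=
  if j = i then LinearMap.prodMap 0 m.q else LinearMap.prodMap (r.e j) 0

theorem idem_apply (j : Q.V) (t : T) (w : Q.DArrow → T) :
    m.idem j (t, w) = if j = i then (0, m.q w) else (r.e j t, 0) := by
  rw [idem]
  split_ifs <;> rfl

open Classical in
theorem φ_ψ_single (a b : Q.DArrow) (t : T) :
    Q.sign a • m.φ (m.ψ (Pi.single a t)) b =
      if Q.dtgt a = i ∧ Q.dtgt b = i then r.x b.swap (r.x a t) else 0 := by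
  rw [m.φ_ψ, outMap_apply, inMap_single]
  by_cases ha : Q.dtgt a = i <;> by_cases hb : Q.dtgt b = i <;>
    simp [ha, hb, smul_smul, sign_mul_self]

/-- The representation obtained by replacing the space at the vertex `i`. -/
noncomputable def rep : Q.OpRep (T × (Q.DArrow → T)) where
  e := m.idem
  x := m.arrow
  e_mul j k := by
    refine LinearMap.ext fun ⟨t, w⟩ => ?_
    rw [Module.End.mul_apply, m.idem_apply k]
    by_cases hk : k = i <;> by_cases hj : j = i <;> by_cases hjk : j = k <;>
      simp_all [idem_apply, m.q_q, e_e_apply]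
  e_tgt_mul a := by
    classical
    refine LinearMap.ext fun ⟨t, w⟩ => ?_
    rw [Module.End.mul_apply, arrow_apply, idem_apply]
    split_ifs with h
    · have h1 : Q.dtgt a.swap ≠ i := by rw [dtgt_swap, ← h]; exact Q.dsrc_ne_dtgt a
      simp [m.φ_apply_of_ne h1, m.q_ψ, awayArrow, h]
    · have h2 : r.e (Q.dtgt a) (m.φ w a.swap) = m.φ w a.swap := by
        rw [← m.nbrProj_φ, nbrProj_apply]
        split_ifs <;> simp [e_e_apply, dsrc_swap]
      rw [m.ψ_single_of_ne h, smul_zero, map_add, h2]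
      congr 2
      rw [awayArrow]
      split_ifs <;> simp [e_x_apply]
  mul_e_src a := by
    classical
    refine LinearMap.ext fun ⟨t, w⟩ => ?_
    rw [Module.End.mul_apply, idem_apply, arrow_apply]
    split_ifs with h
    · have h1 : Q.dtgt a ≠ i := by rw [← h]; exact (Q.dsrc_ne_dtgt a).symm
      simp [arrow_apply, m.φ_q, m.ψ_single_of_ne h1, awayArrow, h]
    · have h1 : Q.dtgt a.swap ≠ i := by rwa [dtgt_swap]
      rw [arrow_apply, m.φ_apply_of_ne h1 w, map_zero, ← m.ψ_nbrProj, nbrProj_single,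
        ← m.ψ_nbrProj (Pi.single a t), nbrProj_single]
      congr 1
      · rw [awayArrow]
        split_ifs <;> simp [x_e_apply]
      · split_ifs <;> simp [e_e_apply]
  rel := by
    classical
    refine LinearMap.ext fun ⟨t, w⟩ => ?_
    simp only [LinearMap.sum_apply, LinearMap.smul_apply, Module.End.mul_apply, arrow_apply,
      LinearMap.zero_apply, Sum.swap_swap]
    have h1 : ∀ a : Q.DArrow, awayArrow r i a (awayArrow r i a.swap t + m.φ w a) +
        m.φ (Q.sign a.swap • m.ψ (Pi.single a.swap t)) a.swap =
        r.x a (r.x a.swap t) - r.e i (r.x a (r.x a.swap t)) := fun a => by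
      rw [map_smul, Pi.smul_apply, φ_ψ_single, dtgt_swap, Sum.swap_swap, e_x_apply, map_add]
      have h := Q.dsrc_ne_dtgt a
      by_cases hs : Q.dsrc a = i <;> by_cases ht : Q.dtgt a = i
      · exact absurd (hs.trans ht.symm) h
      · simp [awayArrow, hs, ht, Ne.symm ht]
      · simp [awayArrow, hs, ht]
      · simp [awayArrow, hs, ht, Ne.symm ht, m.φ_apply_of_ne ht, dsrc_swap, dtgt_swap]
    have h2 : ∀ a : Q.DArrow, Q.sign a • Q.sign a •
        m.ψ (Pi.single a (awayArrow r i a.swap t + m.φ w a)) = m.ψ (Pi.single a (m.φ w a)) :=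
      fun a => by
        rw [smul_smul, sign_mul_self, one_smul]
        by_cases ht : Q.dtgt a = i
        · simp [awayArrow, ht, dsrc_swap]
        · rw [m.ψ_single_of_ne ht, m.ψ_single_of_ne ht]
    simp only [h1, Prod.smul_mk, h2]
    refine Prod.ext ?_ ?_
    · have h3 := r.rel_apply t
      have h4 := congrArg (r.e i) h3
      simp only [map_sum, map_smul, map_zero] at h4
      simp only [Prod.fst_sum, smul_sub, Finset.sum_sub_distrib]
      rw [h3, h4, sub_zero]
      rfl
    · simp only [Prod.snd_sum, ← map_sum, Finset.univ_sum_single, m.ψ_φ]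
      rfl

end Replacement

end Reflection

end OpRep

end LooplessQuiver

theorem exists_comp_eq_of_range_le {K E F G : Type*} [Field K] [AddCommGroup E] [Module K E]
    [AddCommGroup F] [Module K F] [AddCommGroup G] [Module K G] {f : F →ₗ[K] G} {g : E →ₗ[K] G}
    (h : LinearMap.range g ≤ LinearMap.range f) : ∃ s : E →ₗ[K] F, f ∘ₗ s = g := by
  obtain ⟨s, hs⟩ := f.rangeRestrict.exists_rightInverse_of_surjective f.range_rangeRestrict
  refine ⟨s ∘ₗ g.codRestrict (LinearMap.range f) fun t => h ⟨t, rfl⟩, LinearMap.ext fun t => ?_⟩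
  exact congrArg Subtype.val
    (LinearMap.congr_fun hs (g.codRestrict (LinearMap.range f) (fun t => h ⟨t, rfl⟩) t))

theorem exists_comp_eq_of_ker_le {K E F G : Type*} [Field K] [AddCommGroup E] [Module K E]
    [AddCommGroup F] [Module K F] [AddCommGroup G] [Module K G] {f : E →ₗ[K] F} {g : E →ₗ[K] G}
    (h : LinearMap.ker f ≤ LinearMap.ker g) : ∃ s : F →ₗ[K] G, s ∘ₗ f = g := by
  obtain ⟨s, hs⟩ := f.rangeRestrict.exists_rightInverse_of_surjective f.range_rangeRestrict
  obtain ⟨k, hk⟩ := (g ∘ₗ s).exists_extend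
  refine ⟨k, LinearMap.ext fun t => ?_⟩
  have h1 : k (f t) = g (s (f.rangeRestrict t)) := LinearMap.congr_fun hk (f.rangeRestrict t)
  have h2 : f (s (f.rangeRestrict t)) = f t :=
    congrArg Subtype.val (LinearMap.congr_fun hs (f.rangeRestrict t))
  rw [LinearMap.comp_apply, h1, ← sub_eq_zero, ← map_sub]
  exact h (by simp [h2])

namespace LooplessQuiver

variable {Q : LooplessQuiver}

namespace OpRep

variable {T : Type} [AddCommGroup T] [Module ℂ T] {r : Q.OpRep T} {i : Q.V}

namespace Replacement

variable (m : r.Replacement i)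

theorem isNil_rep (h : r.IsNil) : m.rep.IsNil := by
  classical
  obtain ⟨N, hN⟩ := h
  have key : ∀ n, ∀ z ∈ m.rep.pathImage (n + 1), z.1 ∈ r.pathImage n ∧
      ∀ a, m.φ z.2 a.swap ∈ (r.pathImage n).map (r.x a) := by
    intro n
    induction n with
    | zero =>
      intro z hz
      refine ⟨Submodule.mem_top, fun a => ?_⟩
      let S : Submodule ℂ (T × (Q.DArrow → T)) := (LinearMap.range (r.x a)).comap
        (LinearMap.proj a.swap ∘ₗ m.φ ∘ₗ LinearMap.snd ℂ T _)
      have : m.rep.pathImage 1 ≤ S := by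
        refine iSup_le fun b => Submodule.map_le_iff_le_comap.2 fun ⟨t, w⟩ _ => ?_
        change m.φ (Q.sign b • m.ψ (Pi.single b t)) a.swap ∈ LinearMap.range (r.x a)
        rw [map_smul, Pi.smul_apply, φ_ψ_single, Sum.swap_swap]
        split_ifs
        · exact ⟨_, rfl⟩
        · exact zero_mem _
      change _ ∈ (⊤ : Submodule ℂ T).map (r.x a)
      rw [Submodule.map_top]
      exact this hz
    | succ n ih =>
      intro z hz
      let S : Submodule ℂ (T × (Q.DArrow → T)) :=
        (r.pathImage (n + 1)).comap (LinearMap.fst ℂ T _) ⊓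
          ⨅ a, ((r.pathImage (n + 1)).map (r.x a)).comap
            (LinearMap.proj a.swap ∘ₗ m.φ ∘ₗ LinearMap.snd ℂ T _)
      have : m.rep.pathImage (n + 1 + 1) ≤ S := by
        refine iSup_le fun b => Submodule.map_le_iff_le_comap.2 fun ⟨t, w⟩ htw => ?_
        obtain ⟨ht, hw⟩ := ih _ htw
        refine ⟨?_, Submodule.mem_iInf _ |>.2 fun a => ?_⟩
        · change awayArrow r i b t + m.φ w b.swap ∈ r.pathImage (n + 1)
          refine add_mem ?_ (Submodule.mem_iSup_of_mem b (hw b))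
          rw [awayArrow]
          split_ifs
          · exact zero_mem _
          · exact r.x_mem_pathImage b ht
        · change m.φ (Q.sign b • m.ψ (Pi.single b t)) a.swap ∈ (r.pathImage (n + 1)).map (r.x a)
          rw [map_smul, Pi.smul_apply, φ_ψ_single, Sum.swap_swap]
          split_ifs
          · exact Submodule.mem_map_of_mem (r.x_mem_pathImage b ht)
          · exact zero_mem _
      simpa [S] using this hz
  refine ⟨N + 1 + 1, eq_bot_iff.2 (iSup_le fun b => Submodule.map_le_iff_le_comap.2 ?_)⟩
  rintro ⟨t, w⟩ htw
  obtain ⟨ht, hw⟩ := key N _ htw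
  rw [hN, Submodule.mem_bot] at ht
  have hw' := hw b
  rw [hN, Submodule.map_bot, Submodule.mem_bot] at hw'
  change m.arrow b (t, w) = 0
  dsimp only at ht hw'
  rw [arrow_apply, ht, hw']
  simp

theorem isBrick_rep (hr : r.IsBrick)
    (H : ∀ f : Module.End ℂ T, ∀ g : Module.End ℂ (Q.DArrow → T),
      (∀ w, g (m.q w) = m.q (g w)) →
      (∀ w, g (m.ψ w) = m.ψ (f.compLeft Q.DArrow w)) →
      (∀ w, f.compLeft Q.DArrow (m.φ w) = m.φ (g w)) →
      (∀ w, f.compLeft Q.DArrow (r.nbrProj i w) = r.nbrProj i (f.compLeft Q.DArrow w)) →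
      (∃ k : Module.End ℂ T, (∀ t, r.e i (k t) = k t) ∧ (∀ t, k (r.e i t) = k t) ∧
        (∀ w, k (r.inMap i w) = r.inMap i (f.compLeft Q.DArrow w)) ∧
        ∀ t, r.outMap i (k t) = f.compLeft Q.DArrow (r.outMap i t)) ∧
      ∀ c : ℂ, (∀ w, f.compLeft Q.DArrow (r.nbrProj i w) = c • r.nbrProj i w) →
        ∀ w, g (m.q w) = c • m.q w) : m.rep.IsBrick := by
  classical
  intro F hFe hFx
  let f : Module.End ℂ T := LinearMap.fst ℂ _ _ ∘ₗ F ∘ₗ LinearMap.inl ℂ _ _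
  let g : Module.End ℂ (Q.DArrow → T) := LinearMap.snd ℂ _ _ ∘ₗ F ∘ₗ LinearMap.inr ℂ _ _
  have hFe' : ∀ j t w, F (m.idem j (t, w)) = m.idem j (F (t, w)) := fun j t w =>
    LinearMap.congr_fun (hFe j) (t, w)
  have hFx' : ∀ a t w, F (m.arrow a (t, w)) = m.arrow a (F (t, w)) := fun a t w =>
    LinearMap.congr_fun (hFx a) (t, w)
  have hf : ∀ j, j ≠ i → ∀ t, F (r.e j t, 0) = (r.e j (f t), 0) := fun j hj t => by
    have h := hFe' j t 0
    rw [idem_apply, if_neg hj] at h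
    rw [h, ← Prod.mk.eta (p := F (t, 0)), idem_apply, if_neg hj]
    rfl
  have hq' : ∀ w, F (0, m.q w) = (0, m.q (g w)) := fun w => by
    have h := hFe' i 0 w
    rw [idem_apply, if_pos rfl] at h
    rw [h, ← Prod.mk.eta (p := F (0, w)), idem_apply, if_pos rfl]
    rfl
  have hfe : ∀ j, j ≠ i → ∀ t, f (r.e j t) = r.e j (f t) := fun j hj t =>
    congrArg Prod.fst (hf j hj t)
  have hq : ∀ w, g (m.q w) = m.q (g w) := fun w => congrArg Prod.snd (hq' w)
  have hψ1 : ∀ a t, g (m.ψ (Pi.single a t)) = m.ψ (Pi.single a (f t)) := fun a t => by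
    by_cases ha : Q.dtgt a = i
    · have h := congrArg Prod.snd (hFx' a t 0)
      rw [arrow_apply, ← Prod.mk.eta (p := F (t, 0)), arrow_apply, awayArrow,
        if_pos (Or.inr ha)] at h
      have h0 : ((0 : Module.End ℂ T) t + m.φ 0 a.swap, Q.sign a • m.ψ (Pi.single a t)) =
          Q.sign a • ((0 : T), m.ψ (Pi.single a t)) := by simp
      rw [h0, map_smul] at h
      have h' := congrArg (Q.sign a • ·) h
      simp only [Prod.smul_snd, smul_smul, sign_mul_self, one_smul] at h'
      exact h'
    · rw [m.ψ_single_of_ne ha, m.ψ_single_of_ne ha, map_zero]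
  have hψ : ∀ w, g (m.ψ w) = m.ψ (f.compLeft Q.DArrow w) := fun w => by
    conv_lhs => rw [← Finset.univ_sum_single w]
    conv_rhs => rw [← Finset.univ_sum_single (f.compLeft Q.DArrow w)]
    simp only [map_sum, hψ1]
    rfl
  have hφ : ∀ w, f.compLeft Q.DArrow (m.φ w) = m.φ (g w) := fun w => by
    ext a
    change f (m.φ w a) = _
    by_cases ha : Q.dtgt a = i
    · have h := congrArg Prod.fst (hFx' a.swap 0 w)
      rw [arrow_apply, ← Prod.mk.eta (p := F (0, w)), arrow_apply, awayArrow,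
        if_pos (Or.inl ((Q.dsrc_swap a).trans ha))] at h
      simpa [f, g] using h
    · rw [m.φ_apply_of_ne ha, m.φ_apply_of_ne ha, map_zero]
  have hnbr : ∀ w, f.compLeft Q.DArrow (r.nbrProj i w) =
      r.nbrProj i (f.compLeft Q.DArrow w) := fun w => by
    ext a
    change f (r.nbrProj i w a) = _
    rw [nbrProj_apply, nbrProj_apply]
    split_ifs with ha
    · exact hfe _ (fun h => Q.dsrc_ne_dtgt a (h.trans ha.symm)) _
    · exact map_zero f
  have haway : ∀ a, Q.dsrc a ≠ i → Q.dtgt a ≠ i → ∀ t, f (r.x a t) = r.x a (f t) :=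
    fun a hs ht t => by
      have h := congrArg Prod.fst (hFx' a t 0)
      rw [arrow_apply, ← Prod.mk.eta (p := F (t, 0)), arrow_apply, m.ψ_single_of_ne ht,
        m.φ_apply_of_ne (by rwa [dtgt_swap]), m.φ_apply_of_ne (by rwa [dtgt_swap]), awayArrow,
        if_neg (by tauto)] at h
      simpa [f, g] using h
  obtain ⟨⟨k, hek, hke, hin, hout⟩, hc⟩ := H f g hq hψ hφ hnbr
  let Φ : Module.End ℂ T := ∑ j, if j = i then k else r.e j * f
  have hΦ : ∀ t, Φ t = ∑ j, if j = i then k t else r.e j (f t) := fun t => by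
    simp only [Φ, LinearMap.sum_apply]
    exact Finset.sum_congr rfl fun j _ => by split_ifs <;> rfl
  have heΦ : ∀ j t, r.e j (Φ t) = if j = i then k t else r.e j (f t) := fun j t => by
    rw [hΦ, map_sum, Finset.sum_eq_single j]
    · split_ifs with h
      · rw [h, hek]
      · simp [e_e_apply]
    · intro l _ hl
      split_ifs with h
      · rw [← hek, e_e_apply, if_neg (h ▸ hl.symm)]
      · rw [e_e_apply, if_neg hl.symm]
    · simp
  have hΦe : ∀ j t, Φ (r.e j t) = if j = i then k t else r.e j (f t) := fun j t => by
    rw [hΦ, Finset.sum_eq_single j]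
    · split_ifs with h
      · rw [h, hke]
      · rw [← hfe j h, e_e_apply, if_pos rfl, hfe j h]
    · intro l _ hl
      split_ifs with h
      · rw [← hke, e_e_apply, if_neg (h ▸ hl), map_zero]
      · rw [← hfe l h, e_e_apply, if_neg hl, map_zero]
    · simp
  have hkx : ∀ a, Q.dtgt a = i → ∀ t, k (r.x a t) = r.x a (f t) := fun a ha t => by
    have h := hin (Pi.single a t)
    have h' : f.compLeft Q.DArrow (Pi.single a t) = Pi.single a (f t) := by
      ext b
      change f ((Pi.single a t : Q.DArrow → T) b) = _
      rcases eq_or_ne b a with rfl | hb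
      · simp
      · simp [Pi.single_eq_of_ne hb]
    rw [h', inMap_single, inMap_single, if_pos ha, if_pos ha, map_smul] at h
    have h' := congrArg (Q.sign a • ·) h
    simpa only [smul_smul, sign_mul_self, one_smul] using h'
  have hxk : ∀ a, Q.dsrc a = i → ∀ t, r.x a (k t) = f (r.x a t) := fun a ha t => by
    have h := congrFun (hout t) a.swap
    change _ = f (r.outMap i t a.swap) at h
    rwa [outMap_apply, outMap_apply, dtgt_swap, if_pos ha, if_pos ha, Sum.swap_swap] at h
  have hΦx : ∀ a, Φ * r.x a = r.x a * Φ := fun a => LinearMap.ext fun t => by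
    have hl : Φ (r.x a t) = if Q.dtgt a = i then k (r.x a t) else
        r.e (Q.dtgt a) (f (r.x a t)) := by
      conv_lhs => rw [← r.e_tgt_mul a]
      exact hΦe _ _
    have hr : r.x a (Φ t) = if Q.dsrc a = i then r.x a (k t) else r.x a (f t) := by
      conv_lhs => rw [← r.mul_e_src a]
      rw [Module.End.mul_apply, heΦ]
      split_ifs
      · rfl
      · rw [x_e_apply, if_pos rfl]
    rw [Module.End.mul_apply, Module.End.mul_apply, hl, hr]
    have hst := Q.dsrc_ne_dtgt a
    by_cases hs : Q.dsrc a = i <;> by_cases ht : Q.dtgt a = i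
    · exact absurd (hs.trans ht.symm) hst
    · rw [if_neg ht, if_pos hs, hxk a hs, ← hfe _ ht, e_x_apply, if_pos rfl]
    · rw [if_pos ht, if_neg hs, hkx a ht]
    · rw [if_neg ht, if_neg hs, ← hfe _ ht, e_x_apply, if_pos rfl, haway a hs ht]
  obtain ⟨c, hcΦ⟩ := hr Φ (fun j => LinearMap.ext fun t => (hΦe j t).trans (heΦ j t).symm) hΦx
  have hfc : ∀ j, j ≠ i → ∀ t, r.e j (f t) = c • r.e j t := fun j hj t => by
    have h := LinearMap.congr_fun hcΦ (r.e j t)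
    have hu : r.unit (r.e j t) = r.e j t := LinearMap.congr_fun (r.unit_mul_e j) t
    rw [Module.End.mul_apply, LinearMap.smul_apply, hu, hΦe, if_neg hj] at h
    exact h
  have hgc := hc c fun w => by
    ext a
    change f (r.nbrProj i w a) = c • r.nbrProj i w a
    rw [nbrProj_apply]
    split_ifs with ha
    · have : Q.dsrc a ≠ i := fun h => Q.dsrc_ne_dtgt a (h.trans ha.symm)
      rw [hfe _ this, hfc _ this]
    · rw [map_zero, smul_zero]
  refine ⟨c, ?_⟩
  rw [unit, Finset.mul_sum, Finset.smul_sum]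
  refine Finset.sum_congr rfl fun j _ => LinearMap.ext fun ⟨t, w⟩ => ?_
  change F (m.idem j (t, w)) = c • m.idem j (t, w)
  rw [idem_apply]
  split_ifs with h
  · rw [hq', ← hq, hgc, Prod.smul_mk, smul_zero]
  · rw [hf j h, hfc j h, Prod.smul_mk, smul_zero]

theorem trace_nbrProj [FiniteDimensional ℂ T] :
    LinearMap.trace ℂ _ (r.nbrProj i) =
      ∑ a, if Q.dtgt a = i then LinearMap.trace ℂ T (r.e (Q.dsrc a)) else 0 := by
  classical
  have h : r.nbrProj i = ∑ a, if Q.dtgt a = i then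
      LinearMap.single ℂ (fun _ : Q.DArrow => T) a ∘ₗ (r.e (Q.dsrc a) ∘ₗ LinearMap.proj a)
      else 0 := by
    refine LinearMap.ext fun w => ?_
    rw [← Finset.univ_sum_single (r.nbrProj i w), LinearMap.sum_apply]
    refine Finset.sum_congr rfl fun a _ => ?_
    rw [nbrProj_apply]
    split_ifs
    · rfl
    · simp
  rw [h, map_sum]
  refine Finset.sum_congr rfl fun a _ => ?_
  split_ifs
  · rw [LinearMap.trace_comp_comm', LinearMap.comp_assoc, LinearMap.proj_comp_single_same]
    rfl
  · exact map_zero _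

theorem hasDim_rep [FiniteDimensional ℂ T] {d : Q.V → ℤ} (hd : r.HasDim d)
    (h : LinearMap.trace ℂ _ m.q =
      LinearMap.trace ℂ _ (r.nbrProj i) - LinearMap.trace ℂ T (r.e i)) :
    m.rep.HasDim (Q.reflection i d) := by
  intro j
  change LinearMap.trace ℂ _ (m.idem j) = _
  rw [idem, reflection]
  split_ifs with hj
  · subst hj
    rw [LinearMap.trace_prodMap', h, trace_nbrProj, map_zero, hd j, form_single,
      Fintype.sum_sum_type, Finset.sum_add_distrib]
    simp only [dtgt, dsrc, hd _]
    simp only [Pi.sub_apply, Pi.smul_apply, Pi.single_eq_same, smul_eq_mul, mul_one]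
    push_cast
    ring
  · rw [LinearMap.trace_prodMap', map_zero, hd j]
    simp [Pi.single_eq_of_ne hj]

end Replacement

end OpRep

end LooplessQuiver

namespace LooplessQuiver

variable {Q : LooplessQuiver}

namespace OpRep

variable {T : Type} [AddCommGroup T] [Module ℂ T] (r : Q.OpRep T) (i : Q.V)

/-- The replacement of `M_i` by the kernel of `⊕ M_j → M_i`, given a section `s` of this map. -/
def kernelReplacement (s : T →ₗ[ℂ] (Q.DArrow → T)) (hs : ∀ t, r.inMap i (s t) = r.e i t)
    (hps : ∀ t, r.nbrProj i (s t) = s t) (hse : ∀ t, s (r.e i t) = s t) : r.Replacement i where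
  q := r.nbrProj i - s ∘ₗ r.inMap i
  ψ := r.outMap i ∘ₗ r.inMap i
  φ := r.nbrProj i - s ∘ₗ r.inMap i
  q_q w := by simp [nbrProj_nbrProj, hps, inMap_nbrProj, hs, hse]
  q_ψ w := by simp [nbrProj_outMap, inMap_outMap]
  ψ_nbrProj w := by simp [inMap_nbrProj]
  φ_q w := by simp [nbrProj_nbrProj, hps, inMap_nbrProj, hs, hse]
  nbrProj_φ w := by simp [nbrProj_nbrProj, hps]
  ψ_φ w := by simp [inMap_nbrProj, hs, e_inMap]
  φ_ψ w := by simp [nbrProj_outMap, inMap_outMap]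

/-- The replacement of `M_i` by the cokernel of `M_i → ⊕ M_j`, given a retraction `s` of this
map. -/
def cokernelReplacement (s : (Q.DArrow → T) →ₗ[ℂ] T) (hs : ∀ t, s (r.outMap i t) = r.e i t)
    (hsp : ∀ w, s (r.nbrProj i w) = s w) (hes : ∀ w, r.e i (s w) = s w) : r.Replacement i where
  q := r.nbrProj i - r.outMap i ∘ₗ s
  ψ := r.nbrProj i - r.outMap i ∘ₗ s
  φ := r.outMap i ∘ₗ r.inMap i
  q_q w := by simp [nbrProj_nbrProj, hsp, nbrProj_outMap, hs, hes]
  q_ψ w := by simp [nbrProj_nbrProj, hsp, nbrProj_outMap, hs, hes]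
  ψ_nbrProj w := by simp [nbrProj_nbrProj, hsp]
  φ_q w := by simp [inMap_nbrProj, inMap_outMap]
  nbrProj_φ w := by simp [nbrProj_outMap]
  ψ_φ w := by simp [nbrProj_outMap, hs, outMap_e]
  φ_ψ w := by simp [inMap_nbrProj, inMap_outMap]

variable {r i}

theorem exists_kernelReplacement [FiniteDimensional ℂ T] (hr : r.IsBrick)
    {d : Q.V → ℤ} (hd : r.HasDim d)
    (h : LinearMap.range (r.e i) ≤ LinearMap.range (r.inMap i)) :
    ∃ m : r.Replacement i, m.rep.IsBrick ∧ m.rep.HasDim (Q.reflection i d) := by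
  obtain ⟨s₀, hs₀⟩ := exists_comp_eq_of_range_le h
  let s : T →ₗ[ℂ] (Q.DArrow → T) := r.nbrProj i ∘ₗ s₀ ∘ₗ r.e i
  have hs : ∀ t, r.inMap i (s t) = r.e i t := fun t => by
    have h1 := LinearMap.congr_fun hs₀ (r.e i t)
    rw [e_e_apply, if_pos rfl] at h1
    exact (r.inMap_nbrProj i _).trans h1
  have hps : ∀ t, r.nbrProj i (s t) = s t := fun t => r.nbrProj_nbrProj i _
  have hse : ∀ t, s (r.e i t) = s t := fun t => by simp [s, e_e_apply]
  refine ⟨r.kernelReplacement i s hs hps hse, ?_, ?_⟩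
  · refine Replacement.isBrick_rep _ hr fun f g hq hψ hφ hp => ⟨⟨r.inMap i ∘ₗ f.compLeft _ ∘ₗ s,
      fun t => r.e_inMap i _, fun t => by simp [hse], fun w => ?_, fun t => ?_⟩, fun c hc w => ?_⟩
    · have h1 : s (r.inMap i w) = r.nbrProj i w - (r.kernelReplacement i s hs hps hse).φ w := by
        simp [kernelReplacement]
      have h2 : r.inMap i ((r.kernelReplacement i s hs hps hse).φ (g w)) = 0 := by
        simp [kernelReplacement, inMap_nbrProj, hs, e_inMap]
      rw [LinearMap.comp_apply, LinearMap.comp_apply, h1, map_sub, hφ, map_sub, h2, hp,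
        inMap_nbrProj, sub_zero]
    · have h1 := hψ (s t)
      have h2 := hφ (r.outMap i t)
      have h3 := hq (r.outMap i t)
      simp only [kernelReplacement, LinearMap.sub_apply, LinearMap.comp_apply, nbrProj_outMap,
        inMap_outMap, map_zero, sub_zero, hs, outMap_e] at h1 h2 h3
      rw [h2, ← h3, h1]
      rfl
    · have h1 := hφ w
      have h2 : (r.kernelReplacement i s hs hps hse).φ w =
          r.nbrProj i ((r.kernelReplacement i s hs hps hse).φ w) :=
        ((r.kernelReplacement i s hs hps hse).nbrProj_φ w).symm
      rw [h2, hc, ← h2] at h1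
      exact (hq w).trans h1.symm
  · refine Replacement.hasDim_rep _ hd ?_
    simp only [kernelReplacement]
    rw [map_sub, LinearMap.trace_comp_comm']
    congr 2
    exact LinearMap.ext hs

theorem exists_cokernelReplacement [FiniteDimensional ℂ T] (hr : r.IsBrick)
    {d : Q.V → ℤ} (hd : r.HasDim d)
    (h : LinearMap.ker (r.outMap i) ≤ LinearMap.ker (r.e i)) :
    ∃ m : r.Replacement i, m.rep.IsBrick ∧ m.rep.HasDim (Q.reflection i d) := by
  obtain ⟨s₀, hs₀⟩ := exists_comp_eq_of_ker_le h
  let s : (Q.DArrow → T) →ₗ[ℂ] T := r.e i ∘ₗ s₀ ∘ₗ r.nbrProj i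
  have hs : ∀ t, s (r.outMap i t) = r.e i t := fun t => by
    have h1 := congrArg (r.e i) (LinearMap.congr_fun hs₀ t)
    rw [e_e_apply, if_pos rfl] at h1
    simpa only [s, LinearMap.comp_apply, nbrProj_outMap] using h1
  have hsp : ∀ w, s (r.nbrProj i w) = s w := fun w => by simp [s, nbrProj_nbrProj]
  have hes : ∀ w, r.e i (s w) = s w := fun w => by simp [s, e_e_apply]
  let m := r.cokernelReplacement i s hs hsp hes
  have hm : ∀ w, r.nbrProj i w = m.q w + r.outMap i (s w) := fun w => by
    simp [m, cokernelReplacement]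
  refine ⟨m, ?_, ?_⟩
  · refine Replacement.isBrick_rep _ hr fun f g hq hψ hφ hp => ⟨⟨s ∘ₗ f.compLeft _ ∘ₗ r.outMap i,
      fun t => hes _, fun t => by simp [outMap_e], fun w => ?_, fun t => ?_⟩, fun c hc w => ?_⟩
    · have h1 : f.compLeft _ (r.outMap i (r.inMap i w)) = r.outMap i (r.inMap i (g w)) := hφ w
      have h2 : ∀ w, r.inMap i (m.q w) = r.inMap i w := fun w => by
        simp [m, cokernelReplacement, inMap_nbrProj, inMap_outMap]
      have h3 : ∀ w, g (m.q w) = m.q (f.compLeft _ w) := hψ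
      change s (f.compLeft _ (r.outMap i (r.inMap i w))) = _
      rw [h1, hs, e_inMap, ← h2, ← hq, h3, h2]
    · have h1 : m.q (r.outMap i t) = 0 := by
        simp [m, cokernelReplacement, nbrProj_outMap, hs, outMap_e]
      have h2 : m.q (f.compLeft _ (r.outMap i t)) = 0 := by
        have h3 : g (m.q (r.outMap i t)) = m.q (f.compLeft _ (r.outMap i t)) := hψ _
        rw [← h3, h1, map_zero]
      have h4 := hm (f.compLeft _ (r.outMap i t))
      rw [h2, zero_add, ← hp, nbrProj_outMap] at h4
      exact h4.symm
    · have h1 : g (m.q w) = m.q (f.compLeft _ w) := hψ w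
      have h2 : ∀ w, m.q (r.nbrProj i w) = m.q w := m.ψ_nbrProj
      rw [h1, ← h2, ← hp, hc, map_smul, h2]
  · refine Replacement.hasDim_rep _ hd ?_
    simp only [m, cokernelReplacement]
    rw [map_sub, LinearMap.trace_comp_comm']
    congr 2
    exact LinearMap.ext hs

theorem hasDim_simple [FiniteDimensional ℂ T] (hr : r.IsBrick) {d : Q.V → ℤ} (hd : r.HasDim d)
    {v : T} (hv : r.e i v = v) (hv0 : v ≠ 0) (hxv : ∀ a, r.x a v = 0)
    {l : Module.Dual ℂ T} (hl : l ∘ₗ r.e i = l) (hl0 : l ≠ 0) (hlx : ∀ a, l ∘ₗ r.x a = 0) :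
    d = Pi.single i 1 := by
  have hev : ∀ j, r.e j v = if j = i then v else 0 := fun j => by
    conv_lhs => rw [← hv, e_e_apply]
    split_ifs with h
    · rw [h, hv]
    · rfl
  have hle : ∀ j t, l (r.e j t) = if j = i then l t else 0 := fun j t => by
    conv_lhs => rw [← hl, LinearMap.comp_apply, e_e_apply]
    split_ifs with h h' h'
    · exact LinearMap.congr_fun hl t
    · exact absurd h.symm h'
    · exact absurd h'.symm h
    · exact map_zero l
  obtain ⟨c, hc⟩ := hr (l.smulRight v)
    (fun j => LinearMap.ext fun t => by
      simp only [Module.End.mul_apply, LinearMap.smulRight_apply, map_smul, hev, hle]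
      split_ifs <;> simp)
    (fun a => LinearMap.ext fun t => by
      have := LinearMap.congr_fun (hlx a) t
      simp only [LinearMap.comp_apply] at this
      simp [this, hxv])
  have hlu : ∀ t, l (r.unit t) = l t := fun t => by
    simp [unit, LinearMap.sum_apply, map_sum, hle]
  have hc' : ∀ t, l t • v = c • r.unit t := fun t => by
    have := LinearMap.congr_fun hc t
    simpa [hlu] using this
  obtain ⟨t, ht⟩ : ∃ t, l t ≠ 0 := by
    by_contra! h
    exact hl0 (LinearMap.ext h)
  have hc0 : c ≠ 0 := by
    rintro rfl
    have := hc' t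
    rw [zero_smul] at this
    exact (smul_ne_zero ht hv0) this
  have hu : r.unit = (c⁻¹ • l).smulRight v := LinearMap.ext fun t => by
    rw [LinearMap.smulRight_apply, LinearMap.smul_apply, smul_assoc, hc', smul_smul,
      inv_mul_cancel₀ hc0, one_smul]
  have huv : r.unit v = v := by simp [unit, LinearMap.sum_apply, hev]
  have hlv : (c⁻¹ • l) v = 1 := by
    rw [hu, LinearMap.smulRight_apply] at huv
    have h1 : ((c⁻¹ • l) v - 1) • v = 0 := by rw [sub_smul, huv, one_smul, sub_self]
    exact sub_eq_zero.1 ((smul_eq_zero.1 h1).resolve_right hv0)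
  funext j
  have hj : r.e j = if j = i then (c⁻¹ • l).smulRight v else 0 := by
    rw [← r.e_mul_unit j, hu]
    refine LinearMap.ext fun t => ?_
    rw [Module.End.mul_apply, LinearMap.smulRight_apply, map_smul, hev]
    split_ifs <;> simp
  have h := hd j
  rw [hj] at h
  rcases eq_or_ne j i with rfl | hji
  · rw [if_pos rfl, LinearMap.trace_smulRight, hlv] at h
    rw [Pi.single_eq_same]
    exact_mod_cast h.symm
  · rw [if_neg hji, map_zero] at h
    rw [Pi.single_eq_of_ne hji]
    exact_mod_cast h.symm

theorem exists_replacement [FiniteDimensional ℂ T] (hr : r.IsBrick) {d : Q.V → ℤ}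
    (hd : r.HasDim d) (hdi : d ≠ Pi.single i 1) :
    ∃ m : r.Replacement i, m.rep.IsBrick ∧ m.rep.HasDim (Q.reflection i d) := by
  classical
  by_cases hin : LinearMap.range (r.e i) ≤ LinearMap.range (r.inMap i)
  · exact exists_kernelReplacement hr hd hin
  by_cases hout : LinearMap.ker (r.outMap i) ≤ LinearMap.ker (r.e i)
  · exact exists_cokernelReplacement hr hd hout
  refine absurd ?_ hdi
  obtain ⟨_, ⟨t, rfl⟩, ht⟩ := SetLike.not_le_iff_exists.1 hin
  obtain ⟨u, hu, hu'⟩ := SetLike.not_le_iff_exists.1 hout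
  rw [LinearMap.mem_ker] at hu hu'
  obtain ⟨l, hlt, hl⟩ := Submodule.exists_le_ker_of_notMem ht
  refine hasDim_simple hr hd (v := r.e i u) (by simp [e_e_apply]) hu' (fun a => ?_)
    (l := l ∘ₗ r.e i) (LinearMap.ext fun t => by simp [e_e_apply]) (fun h => ?_) (fun a => ?_)
  · rw [x_e_apply]
    split_ifs with ha
    · have := congrFun hu a.swap
      rwa [outMap_apply, dtgt_swap, if_pos ha.symm, Sum.swap_swap] at this
    · rfl
  · exact hlt (by simpa using LinearMap.congr_fun h t)
  · refine LinearMap.ext fun t => ?_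
    rw [LinearMap.comp_apply, LinearMap.comp_apply, e_x_apply]
    split_ifs with ha
    · have h1 : r.x a t = r.inMap i (Pi.single a (Q.sign a • t)) := by
        rw [inMap_single, if_pos ha.symm, map_smul, smul_smul, sign_mul_self, one_smul]
      rw [h1]
      exact hl ⟨_, rfl⟩
    · exact map_zero l

end OpRep

end LooplessQuiver

namespace LooplessQuiver

variable {Q : LooplessQuiver}

namespace OpRep

variable {T : Type} [AddCommGroup T] [Module ℂ T] (r : Q.OpRep T)

theorem isIdempotentElem_e (j : Q.V) : IsIdempotentElem (r.e j) := by
  rw [IsIdempotentElem, e_mul, if_pos rfl]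

theorem finrank_range_e [FiniteDimensional ℂ T] {d : Q.V → ℤ} (hd : r.HasDim d) (j : Q.V) :
    (Module.finrank ℂ (LinearMap.range (r.e j)) : ℤ) = d j := by
  have h := hd j
  rw [(LinearMap.IsIdempotentElem.isProj_range _ (r.isIdempotentElem_e j)).trace] at h
  exact_mod_cast h

theorem unit_e_apply (i : Q.V) (t : T) : r.unit (r.e i t) = r.e i t :=
  LinearMap.congr_fun (r.unit_mul_e i) t

theorem unit_x_apply (a : Q.DArrow) (t : T) : r.unit (r.x a t) = r.x a t :=
  LinearMap.congr_fun (r.unit_mul_x a) t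

theorem unit_apply_of_mem {t : T} (ht : t ∈ LinearMap.range r.unit) : r.unit t = t := by
  obtain ⟨s, rfl⟩ := ht
  exact LinearMap.congr_fun r.unit_mul_unit s

/-- The restriction of the operators to the underlying module. -/
def compress : Q.OpRep (LinearMap.range r.unit) where
  e i := (r.e i).restrict fun t _ => ⟨r.e i t, r.unit_e_apply i t⟩
  x a := (r.x a).restrict fun t _ => ⟨r.x a t, r.unit_x_apply a t⟩
  e_mul i j := LinearMap.ext fun t => Subtype.ext <| by
    change r.e i (r.e j t) = _
    rw [r.e_e_apply]
    split_ifs <;> rfl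
  e_tgt_mul a := LinearMap.ext fun t => Subtype.ext (LinearMap.congr_fun (r.e_tgt_mul a) t)
  mul_e_src a := LinearMap.ext fun t => Subtype.ext (LinearMap.congr_fun (r.mul_e_src a) t)
  rel := LinearMap.ext fun t => Subtype.ext <| by
    rw [LinearMap.sum_apply, AddSubmonoidClass.coe_finsetSum]
    exact r.rel_apply t

theorem compress_unit : r.compress.unit = 1 :=
  LinearMap.ext fun t => Subtype.ext <| by
    change (((∑ i, r.compress.e i) t : LinearMap.range r.unit) : T) = t
    rw [LinearMap.sum_apply, AddSubmonoidClass.coe_finsetSum]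
    exact (LinearMap.sum_apply Finset.univ r.e (t : T)).symm.trans (r.unit_apply_of_mem t.2)

variable {r}

theorem IsNil.compress (h : r.IsNil) : r.compress.IsNil := by
  obtain ⟨N, hN⟩ := h
  have key : ∀ n, (r.compress.pathImage n).map (LinearMap.range r.unit).subtype ≤
      r.pathImage n := by
    intro n
    induction n with
    | zero => exact le_top
    | succ n ih =>
      rw [pathImage, Submodule.map_iSup]
      refine iSup_le fun a => ?_
      rintro _ ⟨_, ⟨t, ht, rfl⟩, rfl⟩
      exact r.x_mem_pathImage a (ih ⟨t, ht, rfl⟩)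
  refine ⟨N, (Submodule.eq_bot_iff _).2 fun t ht => Subtype.ext ?_⟩
  have := key N ⟨t, ht, rfl⟩
  rwa [hN] at this

theorem IsBrick.compress (h : r.IsBrick) : r.compress.IsBrick := by
  intro f he hx
  obtain ⟨c, hc⟩ := h ((LinearMap.range r.unit).subtype ∘ₗ f ∘ₗ r.unit.rangeRestrict)
    (fun i => LinearMap.ext fun t => by
      have h1 := congrArg Subtype.val (LinearMap.congr_fun (he i) (r.unit.rangeRestrict t))
      have h2 : r.compress.e i (r.unit.rangeRestrict t) = r.unit.rangeRestrict (r.e i t) :=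
        Subtype.ext (LinearMap.congr_fun ((r.e_mul_unit i).trans (r.unit_mul_e i).symm) t)
      rw [Module.End.mul_apply, h2] at h1
      exact h1)
    (fun a => LinearMap.ext fun t => by
      have h1 := congrArg Subtype.val (LinearMap.congr_fun (hx a) (r.unit.rangeRestrict t))
      have h2 : r.compress.x a (r.unit.rangeRestrict t) = r.unit.rangeRestrict (r.x a t) :=
        Subtype.ext (LinearMap.congr_fun ((r.x_mul_unit a).trans (r.unit_mul_x a).symm) t)
      rw [Module.End.mul_apply, h2] at h1
      exact h1)
  refine ⟨c, LinearMap.ext fun t => Subtype.ext ?_⟩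
  rw [compress_unit]
  have h1 := LinearMap.congr_fun hc t
  have h2 : r.unit.rangeRestrict (r.unit t) = t :=
    Subtype.ext ((congrArg r.unit (r.unit_apply_of_mem t.2)).trans (r.unit_apply_of_mem t.2))
  rw [Module.End.mul_apply, LinearMap.comp_apply, LinearMap.comp_apply, h2, LinearMap.smul_apply,
    r.unit_apply_of_mem t.2] at h1
  exact h1

theorem HasDim.compress [FiniteDimensional ℂ T] {d : Q.V → ℤ} (h : r.HasDim d) :
    r.compress.HasDim d := fun j =>
  ((r.e j).trace_restrict_eq_of_forall_mem (LinearMap.range r.unit)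
    (fun t => ⟨r.e j t, r.unit_e_apply j t⟩)).trans (h j)

end OpRep

end LooplessQuiver

namespace LooplessQuiver

variable {Q : LooplessQuiver}

theorem form_self_eq (d : Q.V → ℤ) :
    Q.form d d = 2 * ∑ i, d i * d i - ∑ a : Q.DArrow, d (Q.dsrc a) * d (Q.dtgt a) := by
  rw [form, Fintype.sum_sum_type, Finset.sum_add_distrib]
  rfl

namespace OpRep

variable {T : Type} [AddCommGroup T] [Module ℂ T] (r : Q.OpRep T)

/-- The endomorphisms of the underlying graded vector space. -/
def gradedEnd : Submodule ℂ (Module.End ℂ T) where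
  carrier := {φ | ∀ j, φ * r.e j = r.e j * φ}
  zero_mem' j := by simp
  add_mem' h h' j := by rw [add_mul, mul_add, h, h']
  smul_mem' c φ h j := by rw [smul_mul_assoc, mul_smul_comm, h]

/-- Families of operators with the sources and targets of the arrows of the double quiver. -/
def arrowFamilies : Submodule ℂ (Q.DArrow → Module.End ℂ T) where
  carrier := {θ | ∀ a, r.e (Q.dtgt a) * θ a = θ a ∧ θ a * r.e (Q.dsrc a) = θ a}
  zero_mem' a := by simp
  add_mem' h h' a := by
    simp only [Pi.add_apply, mul_add, add_mul, (h a).1, (h' a).1, (h a).2, (h' a).2, and_self]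
  smul_mem' c θ h a := by
    simp only [Pi.smul_apply, mul_smul_comm, smul_mul_assoc, (h a).1, (h a).2, and_self]

/-- The commutator of a graded endomorphism with the arrows. -/
def commutator : r.gradedEnd →ₗ[ℂ] r.arrowFamilies where
  toFun φ := ⟨fun a => r.x a * φ.1 - φ.1 * r.x a, fun a => by
    constructor
    · rw [mul_sub, ← mul_assoc, ← mul_assoc, r.e_tgt_mul, ← φ.2, mul_assoc, r.e_tgt_mul]
    · rw [sub_mul, mul_assoc, mul_assoc, r.mul_e_src, φ.2, ← mul_assoc, r.mul_e_src]⟩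
  map_add' φ φ' := Subtype.ext <| funext fun a => by
    change r.x a * (φ.1 + φ'.1) - (φ.1 + φ'.1) * r.x a =
      (r.x a * φ.1 - φ.1 * r.x a) + (r.x a * φ'.1 - φ'.1 * r.x a)
    rw [mul_add, add_mul]
    abel
  map_smul' c φ := Subtype.ext <| funext fun a => by
    change r.x a * (c • φ.1) - (c • φ.1) * r.x a = c • (r.x a * φ.1 - φ.1 * r.x a)
    rw [mul_smul_comm, smul_mul_assoc, smul_sub]

/-- The linearisation of the preprojective relation. -/
def relDeriv : r.arrowFamilies →ₗ[ℂ] Module.End ℂ T where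
  toFun θ := ∑ a, Q.sign a • (r.x a * θ.1 a.swap + θ.1 a * r.x a.swap)
  map_add' θ θ' := by
    rw [← Finset.sum_add_distrib]
    refine Finset.sum_congr rfl fun a _ => ?_
    change Q.sign a • (r.x a * (θ.1 a.swap + θ'.1 a.swap) + (θ.1 a + θ'.1 a) * r.x a.swap) = _
    rw [mul_add, add_mul, ← smul_add]
    congr 1
    abel
  map_smul' c θ := by
    rw [Finset.smul_sum]
    refine Finset.sum_congr rfl fun a _ => ?_
    change Q.sign a • (r.x a * (c • θ.1 a.swap) + (c • θ.1 a) * r.x a.swap) = _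
    rw [mul_smul_comm, smul_mul_assoc, ← smul_add, smul_comm]
    rfl

theorem relDeriv_commutator (φ : r.gradedEnd) : r.relDeriv (r.commutator φ) = 0 := by
  have h : r.relDeriv (r.commutator φ) =
      (∑ a, Q.sign a • (r.x a * r.x a.swap)) * φ.1 -
        φ.1 * ∑ a, Q.sign a • (r.x a * r.x a.swap) := by
    rw [Finset.sum_mul, Finset.mul_sum, ← Finset.sum_sub_distrib]
    refine Finset.sum_congr rfl fun a _ => ?_
    change Q.sign a • (r.x a * (r.x a.swap * φ.1 - φ.1 * r.x a.swap) +
      (r.x a * φ.1 - φ.1 * r.x a) * r.x a.swap) = _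
    rw [smul_mul_assoc, mul_smul_comm, ← smul_sub]
    congr 1
    noncomm_ring
  rw [h, r.rel, zero_mul, mul_zero, sub_zero]

variable {r}

theorem trace_mul_relDeriv (φ : Module.End ℂ T) (θ : r.arrowFamilies) :
    LinearMap.trace ℂ T (φ * r.relDeriv θ) =
      ∑ a, Q.sign a * LinearMap.trace ℂ T ((r.x a.swap * φ - φ * r.x a.swap) * θ.1 a) := by
  have h1 : ∀ a : Q.DArrow, LinearMap.trace ℂ T (φ * (θ.1 a * r.x a.swap)) =
      LinearMap.trace ℂ T (r.x a.swap * φ * θ.1 a) := fun a => by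
    rw [← mul_assoc, LinearMap.trace_mul_comm, mul_assoc]
  have h2 : ∑ a : Q.DArrow, Q.sign a * LinearMap.trace ℂ T (φ * (r.x a * θ.1 a.swap)) =
      ∑ a : Q.DArrow, -(Q.sign a * LinearMap.trace ℂ T (φ * r.x a.swap * θ.1 a)) := by
    refine Fintype.sum_equiv (Equiv.sumComm _ _) _ _ fun a => ?_
    rw [Equiv.sumComm_apply, Sum.swap_swap, mul_assoc]
    cases a <;> simp [sign]
  change LinearMap.trace ℂ T (φ * ∑ a, Q.sign a • (r.x a * θ.1 a.swap + θ.1 a * r.x a.swap)) = _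
  simp only [Finset.mul_sum, map_sum, mul_smul_comm, map_smul, mul_add, map_add, smul_eq_mul, h1,
    Finset.sum_add_distrib, h2, sub_mul, map_sub, mul_sub, Finset.sum_sub_distrib,
    Finset.sum_neg_distrib]
  abel

theorem eq_zero_of_trace_mul_eq_zero [FiniteDimensional ℂ T] {f : Module.End ℂ T}
    (h : ∀ g : Module.End ℂ T, LinearMap.trace ℂ T (f * g) = 0) : f = 0 := by
  refine LinearMap.ext fun v => (Module.forall_dual_apply_eq_zero_iff ℂ _).1 fun l => ?_
  have h1 : f * l.smulRight v = l.smulRight (f v) := LinearMap.ext fun t => by simp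
  have h2 := h (l.smulRight v)
  rwa [h1, LinearMap.trace_smulRight] at h2

theorem commutator_eq_zero [FiniteDimensional ℂ T] {φ : r.gradedEnd}
    (h : ∀ θ, LinearMap.trace ℂ T (φ.1 * r.relDeriv θ) = 0) : r.commutator φ = 0 := by
  classical
  refine Subtype.ext <| funext fun a => eq_zero_of_trace_mul_eq_zero fun η => ?_
  have hmem : (Pi.single a.swap (r.e (Q.dsrc a) * η * r.e (Q.dtgt a)) :
      Q.DArrow → Module.End ℂ T) ∈ r.arrowFamilies := by
    intro b
    rcases eq_or_ne b a.swap with rfl | hb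
    · rw [Pi.single_eq_same, dtgt_swap, dsrc_swap, mul_assoc, ← mul_assoc, r.e_mul, if_pos rfl,
        mul_assoc, mul_assoc, r.e_mul, if_pos rfl]
      exact ⟨rfl, rfl⟩
    · simp [Pi.single_eq_of_ne hb]
  have h1 := h ⟨_, hmem⟩
  rw [trace_mul_relDeriv, Finset.sum_eq_single a.swap] at h1
  · have h2 : (r.x a * φ.1 - φ.1 * r.x a) * r.e (Q.dsrc a) = r.x a * φ.1 - φ.1 * r.x a :=
      ((r.commutator φ).2 a).2
    have h3 : r.e (Q.dtgt a) * (r.x a * φ.1 - φ.1 * r.x a) = r.x a * φ.1 - φ.1 * r.x a :=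
      ((r.commutator φ).2 a).1
    dsimp only at h1
    rw [Sum.swap_swap, Pi.single_eq_same, ← mul_assoc, LinearMap.trace_mul_comm, ← mul_assoc,
      ← mul_assoc, h3, h2] at h1
    refine (mul_eq_zero.1 h1).resolve_left ?_
    cases a <;> simp [sign]
  · intro b _ hb
    simp [Pi.single_eq_of_ne hb]
  · simp

theorem sum_sq_le_finrank_gradedEnd [FiniteDimensional ℂ T] {d : Q.V → ℤ} (hd : r.HasDim d) :
    ∑ j, d j * d j ≤ Module.finrank ℂ r.gradedEnd := by
  have key : ∀ (β : ∀ j, LinearMap.range (r.e j) →ₗ[ℂ] LinearMap.range (r.e j)) (i : Q.V) (t : T),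
      (∑ j, (LinearMap.range (r.e j)).subtype ∘ₗ β j ∘ₗ (r.e j).rangeRestrict) (r.e i t) =
        β i ((r.e i).rangeRestrict t) := fun β i t => by
    rw [LinearMap.sum_apply, Finset.sum_eq_single i]
    · have h : (r.e i).rangeRestrict (r.e i t) = (r.e i).rangeRestrict t :=
        Subtype.ext ((r.e_e_apply i i t).trans (if_pos rfl))
      exact congrArg (fun u => (β i u : T)) h
    · intro j _ hj
      have h : (r.e j).rangeRestrict (r.e i t) = 0 :=
        Subtype.ext ((r.e_e_apply j i t).trans (if_neg hj))
      rw [LinearMap.comp_apply, LinearMap.comp_apply, h, map_zero, map_zero]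
    · simp
  let F : (∀ j, LinearMap.range (r.e j) →ₗ[ℂ] LinearMap.range (r.e j)) →ₗ[ℂ] r.gradedEnd :=
    { toFun := fun β => ⟨∑ j, (LinearMap.range (r.e j)).subtype ∘ₗ β j ∘ₗ (r.e j).rangeRestrict,
        fun i => LinearMap.ext fun t => by
          have h : ∀ j (u : LinearMap.range (r.e j)), r.e i u = if i = j then (u : T) else 0 := by
            rintro j ⟨_, v, rfl⟩
            rw [r.e_e_apply]
            split_ifs with hij
            · rw [hij]
            · rfl
          rw [Module.End.mul_apply, key, Module.End.mul_apply, LinearMap.sum_apply, map_sum]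
          simp [h]⟩
      map_add' := fun β β' => Subtype.ext <| LinearMap.ext fun t => by
        simp [Finset.sum_add_distrib]
      map_smul' := fun c β => Subtype.ext <| LinearMap.ext fun t => by
        simp [Finset.smul_sum] }
  have hF : Function.Injective F := by
    rw [injective_iff_map_eq_zero]
    intro β hβ
    refine funext fun i => LinearMap.ext ?_
    rintro ⟨_, t, rfl⟩
    refine Subtype.ext ((key β i t).symm.trans ?_)
    exact LinearMap.congr_fun (congrArg Subtype.val hβ) _
  have h := LinearMap.finrank_le_finrank_of_injective hF
  rw [Module.finrank_pi_fintype] at h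
  simp only [Module.finrank_linearMap] at h
  simp only [← r.finrank_range_e hd]
  exact_mod_cast h

theorem finrank_arrowFamilies_le [FiniteDimensional ℂ T] {d : Q.V → ℤ} (hd : r.HasDim d) :
    Module.finrank ℂ r.arrowFamilies ≤ ∑ a : Q.DArrow, d (Q.dsrc a) * d (Q.dtgt a) := by
  let F : r.arrowFamilies →ₗ[ℂ]
      (∀ a, LinearMap.range (r.e (Q.dsrc a)) →ₗ[ℂ] LinearMap.range (r.e (Q.dtgt a))) :=
    { toFun := fun θ a => (r.e (Q.dtgt a)).rangeRestrict ∘ₗ θ.1 a ∘ₗ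
        (LinearMap.range (r.e (Q.dsrc a))).subtype
      map_add' := fun θ θ' => funext fun a => LinearMap.ext fun t =>
        Subtype.ext (map_add (r.e _) _ _)
      map_smul' := fun c θ => funext fun a => LinearMap.ext fun t =>
        Subtype.ext (map_smul (r.e _) _ _) }
  have hF : Function.Injective F := by
    rw [injective_iff_map_eq_zero]
    intro θ h
    refine Subtype.ext <| funext fun a => LinearMap.ext fun t => ?_
    have h1 : r.e (Q.dtgt a) (θ.1 a (r.e (Q.dsrc a) t)) = 0 :=
      congrArg Subtype.val (LinearMap.congr_fun (congrFun h a) ⟨_, t, rfl⟩)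
    have h2 := LinearMap.congr_fun (θ.2 a).2 t
    have h3 := LinearMap.congr_fun (θ.2 a).1 (r.e (Q.dsrc a) t)
    exact h2.symm.trans (h3.symm.trans h1)
  have h := LinearMap.finrank_le_finrank_of_injective hF
  rw [Module.finrank_pi_fintype] at h
  simp only [Module.finrank_linearMap] at h
  simp only [← r.finrank_range_e hd]
  exact_mod_cast h

theorem finrank_ker_commutator_le [FiniteDimensional ℂ T] (hr : r.IsBrick) (hu : r.unit = 1) :
    Module.finrank ℂ (LinearMap.ker r.commutator) ≤ 1 := by
  have h1 : (LinearMap.ker r.commutator).map r.gradedEnd.subtype ≤ Submodule.span ℂ {1} := by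
    rintro _ ⟨φ, hφ, rfl⟩
    obtain ⟨c, hc⟩ := hr φ.1 φ.2 fun a =>
      (sub_eq_zero.1 (congrFun (congrArg Subtype.val hφ) a)).symm
    rw [hu, mul_one] at hc
    exact Submodule.mem_span_singleton.2 ⟨c, hc.symm⟩
  have h2 := Submodule.finrank_mono h1
  rw [Submodule.finrank_map_subtype_eq] at h2
  exact h2.trans ((finrank_span_le_card _).trans (by simp))

theorem exists_commutator_eq [FiniteDimensional ℂ T] (hr : r.IsBrick) {d : Q.V → ℤ}
    (hd : r.HasDim d) (hdd : Q.form d d = 2) (hu : r.unit = 1) {θ : r.arrowFamilies}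
    (hθ : r.relDeriv θ = 0) : ∃ φ, r.commutator φ = θ := by
  let Ψ : r.gradedEnd →ₗ[ℂ] Module.Dual ℂ r.arrowFamilies :=
    r.relDeriv.dualMap ∘ₗ (LinearMap.mul ℂ (Module.End ℂ T)).compr₂ (LinearMap.trace ℂ T) ∘ₗ
      r.gradedEnd.subtype
  have hΨ : LinearMap.ker Ψ ≤ LinearMap.ker r.commutator := fun φ hφ =>
    commutator_eq_zero fun θ => LinearMap.congr_fun hφ θ
  have h1 := Submodule.finrank_mono hΨ
  have h2 : Module.finrank ℂ (LinearMap.range Ψ) ≤ Module.finrank ℂ (LinearMap.range r.relDeriv) :=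
    (Submodule.finrank_mono (LinearMap.range_comp_le_range _ _)).trans
      (LinearMap.finrank_range_dualMap_eq_finrank_range _).le
  have h3 := Ψ.finrank_range_add_finrank_ker
  have h4 := r.relDeriv.finrank_range_add_finrank_ker
  have h5 := r.commutator.finrank_range_add_finrank_ker
  have h6 := finrank_ker_commutator_le hr hu
  have h7 := sum_sq_le_finrank_gradedEnd hd
  have h8 := finrank_arrowFamilies_le hd
  rw [form_self_eq] at hdd
  have hle : LinearMap.range r.commutator ≤ LinearMap.ker r.relDeriv := by
    rintro _ ⟨φ, rfl⟩
    exact r.relDeriv_commutator φ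
  have heq := Submodule.eq_of_le_of_finrank_le hle (by omega)
  exact heq.ge hθ

end OpRep

end LooplessQuiver

namespace LooplessQuiver

attribute [local instance] ModuleCat.moduleOfAlgebraModule
  ModuleCat.isScalarTower_of_algebra_moduleCat

section Presentation

variable (Q : LooplessQuiver)

theorem sum_sign_smul {E : Type*} [Ring E] [Algebra ℂ E] (x : Q.DArrow → E) :
    ∑ a : Q.DArrow, Q.sign a • (x a * x a.swap) =
      ∑ a : Q.A, (x (Sum.inl a) * x (Sum.inr a) - x (Sum.inr a) * x (Sum.inl a)) := by
  rw [Fintype.sum_sum_type, Finset.sum_sub_distrib, sub_eq_add_neg, ← Finset.sum_neg_distrib]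
  congr 1 <;> exact Finset.sum_congr rfl fun a _ => by simp [sign]

theorem pe_mul_pe (i j : Q.V) : Q.pe i * Q.pe j = if i = j then Q.pe i else 0 := by
  have h := RingQuot.mkAlgHom_rel ℂ (Rel.vertex_mul (Q := Q) i j)
  rw [map_mul] at h
  refine h.trans ?_
  split_ifs
  · rfl
  · exact map_zero _

theorem sum_pe : ∑ i, Q.pe i = 1 := by
  have h := RingQuot.mkAlgHom_rel ℂ (Rel.vertex_sum (Q := Q))
  rwa [map_sum, map_one] at h

theorem pe_mul_px (a : Q.DArrow) : Q.pe (Q.dtgt a) * Q.px a = Q.px a := by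
  have h := RingQuot.mkAlgHom_rel ℂ (Rel.arrow_left (Q := Q) a)
  rwa [map_mul] at h

theorem px_mul_pe (a : Q.DArrow) : Q.px a * Q.pe (Q.dsrc a) = Q.px a := by
  have h := RingQuot.mkAlgHom_rel ℂ (Rel.arrow_right (Q := Q) a)
  rwa [map_mul] at h

theorem sum_px : ∑ a : Q.DArrow, Q.sign a • (Q.px a * Q.px a.swap) = 0 := by
  have h := RingQuot.mkAlgHom_rel ℂ (Rel.preprojective (Q := Q))
  rw [sum_sign_smul]
  simp only [map_sum, map_sub, map_mul, map_zero] at h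
  exact h

variable {Q}

/-- Linearity over `P(Q)` can be checked on generators. -/
theorem map_smul_of_generators {M N : ModuleCat.{0} Q.Preproj} {h : M →ₗ[ℂ] N}
    (he : ∀ i m, h (Q.pe i • m) = Q.pe i • h m) (hx : ∀ a m, h (Q.px a • m) = Q.px a • h m)
    (p : Q.Preproj) (m : M) : h (p • m) = p • h m := by
  obtain ⟨w, rfl⟩ := RingQuot.mkAlgHom_surjective ℂ Q.Rel p
  induction w generalizing m with
  | grade0 c =>
    rw [AlgHom.commutes, algebraMap_smul, algebraMap_smul, map_smul]
  | grade1 g =>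
    cases g with
    | inl i => exact he i m
    | inr a => exact hx a m
  | mul u v hu hv => rw [map_mul, mul_smul, mul_smul, hu, hv]
  | add u v hu hv => rw [map_add, add_smul, add_smul, map_add, hu, hv]

end Presentation

variable {Q : LooplessQuiver}

/-- The operators by which the generators act on a module. -/
noncomputable def moduleRep (M : ModuleCat.{0} Q.Preproj) : Q.OpRep M where
  e i := Algebra.lsmul ℂ ℂ M (Q.pe i)
  x a := Algebra.lsmul ℂ ℂ M (Q.px a)
  e_mul i j := by
    rw [← map_mul, pe_mul_pe]
    split_ifs
    · rfl
    · exact map_zero _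
  e_tgt_mul a := by rw [← map_mul, pe_mul_px]
  mul_e_src a := by rw [← map_mul, px_mul_pe]
  rel := by
    simp only [← map_mul, ← map_smul, ← map_sum, sum_px, map_zero]

theorem moduleRep_unit (M : ModuleCat.{0} Q.Preproj) : (moduleRep M).unit = 1 := by
  change ∑ i, Algebra.lsmul ℂ ℂ M (Q.pe i) = 1
  rw [← map_sum, sum_pe, map_one]

namespace OpRep

variable {T T' : Type} [AddCommGroup T] [Module ℂ T] [AddCommGroup T'] [Module ℂ T']
  {r : Q.OpRep T} {r' : Q.OpRep T'} {φ : T ≃ₗ[ℂ] T'}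

theorem IsNil.of_equiv (h : r.IsNil) (hx : ∀ a t, φ (r.x a t) = r'.x a (φ t)) : r'.IsNil := by
  obtain ⟨N, hN⟩ := h
  have key : ∀ n, r'.pathImage n ≤ (r.pathImage n).map (φ : T →ₗ[ℂ] T') := by
    intro n
    induction n with
    | zero =>
      intro t _
      exact ⟨φ.symm t, trivial, φ.apply_symm_apply t⟩
    | succ n ih =>
      refine iSup_le fun a => ?_
      rintro _ ⟨t, ht, rfl⟩
      obtain ⟨s, hs, rfl⟩ := ih ht
      exact ⟨r.x a s, r.x_mem_pathImage a hs, hx a s⟩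
  refine ⟨N, le_bot_iff.1 ((key N).trans ?_)⟩
  rw [hN, Submodule.map_bot]

theorem IsBrick.of_equiv (h : r.IsBrick) (he : ∀ i t, φ (r.e i t) = r'.e i (φ t))
    (hx : ∀ a t, φ (r.x a t) = r'.x a (φ t)) : r'.IsBrick := by
  intro f hfe hfx
  obtain ⟨c, hc⟩ := h (φ.symm.conj f)
    (fun i => LinearMap.ext fun t => φ.injective <| by
      simpa [LinearEquiv.conj_apply, he] using LinearMap.congr_fun (hfe i) (φ t))
    (fun a => LinearMap.ext fun t => φ.injective <| by
      simpa [LinearEquiv.conj_apply, hx] using LinearMap.congr_fun (hfx a) (φ t))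
  have hu : ∀ t, φ (r.unit t) = r'.unit (φ t) := fun t => by
    simp [unit, LinearMap.sum_apply, he]
  refine ⟨c, LinearMap.ext fun t => ?_⟩
  have h1 := congrArg φ (LinearMap.congr_fun hc (φ.symm t))
  simpa [LinearEquiv.conj_apply, hu] using h1

theorem HasDim.of_equiv {d : Q.V → ℤ} (h : r.HasDim d)
    (he : ∀ i t, φ (r.e i t) = r'.e i (φ t)) : r'.HasDim d := fun j => by
  have h1 : r'.e j = φ.conj (r.e j) := LinearMap.ext fun t => by
    simp [LinearEquiv.conj_apply, he]
  rw [h1, LinearMap.trace_conj']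
  exact h j

/-- The action of `P(Q)` defined by a unital representation. -/
noncomputable def action (r : Q.OpRep T) (hu : r.unit = 1) : Q.Preproj →ₐ[ℂ] Module.End ℂ T :=
  RingQuot.liftAlgHom ℂ ⟨FreeAlgebra.lift ℂ (Sum.elim r.e r.x), fun u v h => by
    cases h with
    | vertex_mul i j =>
      simp only [LooplessQuiver.e, map_mul, FreeAlgebra.lift_ι_apply, Sum.elim_inl, r.e_mul]
      split_ifs
      · simp
      · simp
    | vertex_sum =>
      simp only [LooplessQuiver.e, map_sum, map_one, FreeAlgebra.lift_ι_apply, Sum.elim_inl]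
      exact hu
    | arrow_left a =>
      simp only [LooplessQuiver.e, LooplessQuiver.x, map_mul, FreeAlgebra.lift_ι_apply,
        Sum.elim_inl, Sum.elim_inr, r.e_tgt_mul]
    | arrow_right a =>
      simp only [LooplessQuiver.e, LooplessQuiver.x, map_mul, FreeAlgebra.lift_ι_apply,
        Sum.elim_inl, Sum.elim_inr, r.mul_e_src]
    | preprojective =>
      simp only [LooplessQuiver.x, map_sum, map_sub, map_mul, map_zero,
        FreeAlgebra.lift_ι_apply, Sum.elim_inr]
      exact (Q.sum_sign_smul r.x).symm.trans r.rel⟩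

theorem action_pe (r : Q.OpRep T) (hu : r.unit = 1) (i : Q.V) : r.action hu (Q.pe i) = r.e i := by
  simp [action, pe, LooplessQuiver.e]

theorem action_px (r : Q.OpRep T) (hu : r.unit = 1) (a : Q.DArrow) :
    r.action hu (Q.px a) = r.x a := by
  simp [action, px, LooplessQuiver.x]

theorem exists_moduleRep_equiv (r : Q.OpRep T) (hu : r.unit = 1) :
    ∃ (M : ModuleCat.{0} Q.Preproj) (φ : T ≃ₗ[ℂ] M),
      (∀ i t, φ (r.e i t) = (moduleRep M).e i (φ t)) ∧
        ∀ a t, φ (r.x a t) = (moduleRep M).x a (φ t) := by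
  let _ : Module Q.Preproj T := Module.compHom T (r.action hu).toRingHom
  obtain ⟨M, hM⟩ : ∃ M, M = ModuleCat.of Q.Preproj T := ⟨_, rfl⟩
  let φ : T ≃+ M := hM ▸ AddEquiv.refl T
  have hφ : ∀ (p : Q.Preproj) t, φ (r.action hu p t) = p • φ t := by
    subst hM
    exact fun _ _ => rfl
  refine ⟨M, φ.toLinearEquiv fun c t => ?_, fun i t => ?_, fun a t => ?_⟩
  · rw [← algebraMap_smul Q.Preproj c (φ t), ← hφ, AlgHom.commutes]
    rfl
  · change φ (r.e i t) = Q.pe i • φ t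
    rw [← hφ, action_pe]
  · change φ (r.x a t) = Q.px a • φ t
    rw [← hφ, action_px]

end OpRep

end LooplessQuiver

theorem subsingleton_ext_one {R C : Type*} [Ring R] [Category* C] [Abelian C] [Linear R C]
    [EnoughProjectives C] {X Y : C} (P : ProjectiveResolution X)
    (h : ∀ f : P.complex.X 1 ⟶ Y, P.complex.d 2 1 ≫ f = 0 →
      ∃ g : P.complex.X 0 ⟶ Y, P.complex.d 1 0 ≫ g = f) :
    Subsingleton (((Ext R C 1).obj (Opposite.op X)).obj Y) := by
  refine ModuleCat.subsingleton_of_isZero (IsZero.of_iso ?_ (P.isoExt 1 Y))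
  rw [← HomologicalComplex.exactAt_iff_isZero_homology,
    HomologicalComplex.exactAt_iff' _ 0 1 2 (by simp) (by simp),
    ShortComplex.moduleCat_exact_iff]
  intro f hf
  obtain ⟨g, hg⟩ := h f hf
  exact ⟨g, hg⟩

namespace LooplessQuiver

attribute [local instance] ModuleCat.moduleOfAlgebraModule
  ModuleCat.isScalarTower_of_algebra_moduleCat

variable {Q : LooplessQuiver}

/-- A surjection of modules has a section of the underlying graded vector spaces. -/
theorem exists_graded_section {M P : ModuleCat.{0} Q.Preproj} (π : P ⟶ M)
    (hπ : Function.Surjective π) :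
    ∃ s : M →ₗ[ℂ] P, (∀ m, π (s m) = m) ∧ ∀ i m, s (Q.pe i • m) = Q.pe i • s m := by
  obtain ⟨s₀, hs₀⟩ := (π.hom.restrictScalars ℂ).exists_rightInverse_of_surjective
    (LinearMap.range_eq_top.2 hπ)
  refine ⟨∑ j, (moduleRep P).e j ∘ₗ s₀ ∘ₗ (moduleRep M).e j, fun m => ?_, fun i m => ?_⟩
  · have h : ∀ j, π ((moduleRep P).e j (s₀ ((moduleRep M).e j m))) = Q.pe j • m := fun j => by
      have h1 : π (s₀ (Q.pe j • m)) = Q.pe j • m := LinearMap.congr_fun hs₀ _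
      change π (Q.pe j • s₀ (Q.pe j • m)) = _
      rw [map_smul, h1, smul_smul, pe_mul_pe, if_pos rfl]
    rw [LinearMap.sum_apply, map_sum]
    refine (Finset.sum_congr rfl fun j _ => h j).trans ?_
    rw [← Finset.sum_smul, sum_pe, one_smul]
  · change _ = (moduleRep P).e i _
    change (∑ j, (moduleRep P).e j ∘ₗ s₀ ∘ₗ (moduleRep M).e j) ((moduleRep M).e i m) = _
    simp only [LinearMap.sum_apply, LinearMap.comp_apply, map_sum, OpRep.e_e_apply]
    rw [Finset.sum_eq_single i, Finset.sum_eq_single i]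
    · simp
    · intro j _ hj
      rw [if_neg hj.symm]
    · simp
    · intro j _ hj
      rw [if_neg hj, map_zero, map_zero]
    · simp

theorem exists_extension {M P₀ P₁ : ModuleCat.{0} Q.Preproj} (d : P₁ ⟶ P₀) (π : P₀ ⟶ M)
    (hπ : Function.Surjective π) (hdπ : ∀ p, π p = 0 ↔ ∃ q, d q = p) (f : P₁ ⟶ M)
    (hf : ∀ p, d p = 0 → f p = 0)
    (hM : ∀ θ, (moduleRep M).relDeriv θ = 0 → ∃ φ, (moduleRep M).commutator φ = θ) :
    ∃ g : P₀ ⟶ M, d ≫ g = f := by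
  obtain ⟨s, hs, hse⟩ := exists_graded_section π hπ
  obtain ⟨G, hG⟩ := exists_comp_eq_of_ker_le (f := d.hom.restrictScalars ℂ)
    (g := f.hom.restrictScalars ℂ) hf
  have hGd : ∀ q, G (d q) = f q := fun q => LinearMap.congr_fun hG q
  have hGs : ∀ (p : Q.Preproj) k, π k = 0 → G (p • k) = p • G k := fun p k hk => by
    obtain ⟨q, rfl⟩ := (hdπ k).1 hk
    rw [← map_smul, hGd, hGd, map_smul]
  have hker : ∀ (p : Q.Preproj) m, π (p • s m - s (p • m)) = 0 := fun p m => by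
    rw [map_sub, map_smul, hs, hs, sub_self]
  let θ : Q.DArrow → Module.End ℂ M := fun a =>
    G ∘ₗ ((moduleRep P₀).x a ∘ₗ s - s ∘ₗ (moduleRep M).x a)
  have hθ : ∀ a m, θ a m = G (Q.px a • s m - s (Q.px a • m)) := fun _ _ => rfl
  have hmem : θ ∈ (moduleRep M).arrowFamilies := fun a => by
    constructor
    · refine LinearMap.ext fun m => ?_
      change Q.pe (Q.dtgt a) • θ a m = θ a m
      rw [hθ, ← hGs _ _ (hker _ m), smul_sub, smul_smul, pe_mul_px, ← hse, smul_smul, pe_mul_px]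
    · refine LinearMap.ext fun m => ?_
      change θ a (Q.pe (Q.dsrc a) • m) = θ a m
      rw [hθ, hθ, hse, smul_smul, smul_smul, px_mul_pe]
  have hrel : (moduleRep M).relDeriv ⟨θ, hmem⟩ = 0 := by
    refine LinearMap.ext fun m => ?_
    change (∑ a, Q.sign a • ((moduleRep M).x a * θ a.swap + θ a * (moduleRep M).x a.swap)) m = 0
    have h1 : ∀ a : Q.DArrow, Q.px a • θ a.swap m + θ a (Q.px a.swap • m) =
        G ((Q.px a * Q.px a.swap) • s m - s ((Q.px a * Q.px a.swap) • m)) := fun a => by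
      rw [hθ, hθ, ← hGs _ _ (hker _ m), ← map_add, smul_sub, smul_smul, smul_smul]
      congr 1
      abel
    have h2 : ∀ (N : ModuleCat.{0} Q.Preproj) (n : N),
        ∑ a : Q.DArrow, Q.sign a • (Q.px a * Q.px a.swap) • n = 0 := fun N n => by
      simp only [← smul_assoc, ← Finset.sum_smul, sum_px, zero_smul]
    rw [LinearMap.sum_apply]
    refine (Finset.sum_congr rfl fun a _ => congrArg (Q.sign a • ·) (h1 a)).trans ?_
    simp only [← map_smul, ← map_sum, smul_sub, Finset.sum_sub_distrib, h2, map_zero, sub_zero]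
  obtain ⟨φ, hφ⟩ := hM _ hrel
  have hφx : ∀ a m, Q.px a • φ.1 m - φ.1 (Q.px a • m) = θ a m := fun a m =>
    LinearMap.congr_fun (congrFun (congrArg Subtype.val hφ) a) m
  have hφe : ∀ i m, φ.1 (Q.pe i • m) = Q.pe i • φ.1 m := fun i m => LinearMap.congr_fun (φ.2 i) m
  let h : P₀ →ₗ[ℂ] M := G - (G ∘ₗ s - φ.1) ∘ₗ π.hom.restrictScalars ℂ
  have hh : ∀ p, h p = G (p - s (π p)) + φ.1 (π p) := fun p => by
    rw [map_sub, sub_add]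
    rfl
  have hk : ∀ p, π (p - s (π p)) = 0 := fun p => by rw [map_sub, hs, sub_self]
  have hlin := map_smul_of_generators (h := h)
    (fun i p => by
      rw [hh, hh, smul_add, ← hGs _ _ (hk p), map_smul, hse, hφe, smul_sub])
    (fun a p => by
      have h1 : Q.px a • p - s (Q.px a • π p) =
          Q.px a • (p - s (π p)) + (Q.px a • s (π p) - s (Q.px a • π p)) := by
        rw [smul_sub]
        abel
      rw [hh, hh, smul_add, map_smul, h1, map_add, hGs _ _ (hk p), ← hθ, ← hφx]
      abel)
  refine ⟨ModuleCat.ofHom { toFun := h, map_add' := map_add h, map_smul' := hlin }, ?_⟩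
  ext q
  change h (d q) = f q
  rw [hh, (hdπ _).2 ⟨q, rfl⟩, map_zero, map_zero, sub_zero, add_zero, hGd]

theorem isRigid_of_commutator {M : ModuleCat.{0} Q.Preproj}
    (hM : ∀ θ, (moduleRep M).relDeriv θ = 0 → ∃ φ, (moduleRep M).commutator φ = θ) :
    Q.IsRigid M := by
  obtain ⟨P⟩ := (inferInstance : HasProjectiveResolution M).out
  refine subsingleton_ext_one P fun f hf => ?_
  have h0 := (ShortComplex.moduleCat_exact_iff _).1 P.exact₀
  have h1 := (ShortComplex.moduleCat_exact_iff _).1 (P.exact_succ 0)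
  refine exists_extension (P.complex.d 1 0) (P.π.f 0) ?_ (fun p => ⟨h0 p, ?_⟩) f (fun p hp => ?_) hM
  · exact (ModuleCat.epi_iff_surjective _).1 inferInstance
  · rintro ⟨q, rfl⟩
    exact ConcreteCategory.congr_hom P.complex_d_comp_π_f_zero q
  · obtain ⟨q, rfl⟩ := h1 p hp
    exact ConcreteCategory.congr_hom hf q

end LooplessQuiver

namespace LooplessQuiver

attribute [local instance] ModuleCat.moduleOfAlgebraModule
  ModuleCat.isScalarTower_of_algebra_moduleCat

variable {Q : LooplessQuiver}

section ModuleRep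

variable {M : ModuleCat.{0} Q.Preproj}

theorem isNilpotentMod_of_isNil (h : (moduleRep M).IsNil) : Q.IsNilpotentMod M := by
  obtain ⟨N, hN⟩ := h
  have key : ∀ (l : List Q.DArrow) (m : M),
      (l.map Q.px).prod • m ∈ (moduleRep M).pathImage l.length := by
    intro l m
    induction l with
    | nil => exact trivial
    | cons a l ih =>
      rw [List.map_cons, List.prod_cons, mul_smul]
      exact (moduleRep M).x_mem_pathImage a ih
  refine ⟨N, fun l hl m => ?_⟩
  have h := key l m
  rwa [hl, hN, Submodule.mem_bot] at h

theorem dimVec_eq [FiniteDimensional ℂ M] {d : Q.V → ℤ} (hd : (moduleRep M).HasDim d) :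
    Q.dimVec M = d := by
  funext i
  have h : Submodule.span ℂ (Set.range fun m : M => Q.pe i • m) =
      LinearMap.range ((moduleRep M).e i) :=
    Submodule.span_eq (LinearMap.range ((moduleRep M).e i))
  rw [dimVec, dimAt, h]
  exact (moduleRep M).finrank_range_e hd i

theorem isBrick_of_moduleRep {d : Q.V → ℤ} (hr : (moduleRep M).IsBrick)
    (hd : (moduleRep M).HasDim d) (hd0 : d ≠ 0) : Q.IsBrick M := by
  constructor
  · by_contra! h
    refine hd0 (funext fun j => ?_)
    have h1 := hd j
    rw [show (moduleRep M).e j = 0 from LinearMap.ext fun m => h _, map_zero] at h1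
    exact_mod_cast h1.symm
  · intro f
    obtain ⟨c, hc⟩ := hr (f.hom.restrictScalars ℂ)
      (fun i => LinearMap.ext fun m => map_smul f.hom (Q.pe i) m)
      (fun a => LinearMap.ext fun m => map_smul f.hom (Q.px a) m)
    refine ⟨c, fun m => ?_⟩
    rw [moduleRep_unit, mul_one] at hc
    rw [algebraMap_smul]
    exact LinearMap.congr_fun hc m

theorem dimVec_eq_of_iso {N : ModuleCat.{0} Q.Preproj} (φ : M ≅ N) : Q.dimVec M = Q.dimVec N := by
  funext i
  let ψ : M ≃ₗ[ℂ] N := φ.toLinearEquiv.restrictScalars ℂ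
  have h : (Submodule.span ℂ (Set.range fun m : M => Q.pe i • m)).map (ψ : M →ₗ[ℂ] N) =
      Submodule.span ℂ (Set.range fun n : N => Q.pe i • n) := by
    rw [Submodule.map_span, ← Set.range_comp]
    congr 1
    ext n
    constructor
    · rintro ⟨m, rfl⟩
      exact ⟨φ.toLinearEquiv m, (map_smul φ.toLinearEquiv _ _).symm⟩
    · rintro ⟨n, rfl⟩
      refine ⟨φ.toLinearEquiv.symm n, (map_smul φ.toLinearEquiv _ _).trans ?_⟩
      rw [LinearEquiv.apply_symm_apply]
  rw [dimVec, dimVec, dimAt, dimAt, ← h, LinearEquiv.finrank_map_eq]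

end ModuleRep

variable (Q) in
/-- The real root `d` is the dimension vector of a nilpotent brick. -/
def IsBrickRoot (d : Q.V → ℤ) : Prop :=
  Q.form d d = 2 ∧ ∃ (T : Type) (_ : AddCommGroup T) (_ : Module ℂ T) (r : Q.OpRep T),
    FiniteDimensional ℂ T ∧ r.IsBrick ∧ r.IsNil ∧ r.HasDim d

theorem IsBrickRoot.nonneg {d : Q.V → ℤ} (hd : Q.IsBrickRoot d) (j : Q.V) : 0 ≤ d j := by
  obtain ⟨_, T, _, _, r, _, _, _, h⟩ := hd
  rw [← r.finrank_range_e h]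
  exact Int.natCast_nonneg _

theorem IsBrickRoot.reflection {d : Q.V → ℤ} (hd : Q.IsBrickRoot d) {i : Q.V}
    (hdi : d ≠ Pi.single i 1) : Q.IsBrickRoot (Q.reflection i d) := by
  obtain ⟨hdd, T, _, _, r, _, hb, hn, hd⟩ := hd
  obtain ⟨m, hmb, hmd⟩ := OpRep.exists_replacement hb hd hdi
  exact ⟨(Q.form_reflection_self i d).trans hdd, _, _, _, m.rep, inferInstance, hmb,
    m.isNil_rep hn, hmd⟩

variable (Q) in
theorem isBrickRoot_single (i : Q.V) : Q.IsBrickRoot (Pi.single i 1) := by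
  let r : Q.OpRep ℂ :=
    { e := Pi.single i 1
      x := 0
      e_mul := fun j k => by
        rcases eq_or_ne j i with rfl | hj
        · rcases eq_or_ne j k with rfl | hk
          · simp
          · simp [hk]
        · simp [Pi.single_eq_of_ne hj]
      e_tgt_mul := fun a => by simp
      mul_e_src := fun a => by simp
      rel := by simp }
  refine ⟨Q.form_single_self i, ℂ, _, _, r, inferInstance, fun f _ _ => ⟨f 1, ?_⟩, ⟨1, ?_⟩,
    fun j => ?_⟩
  · have hu : r.unit = 1 := by simp [OpRep.unit, r]
    rw [hu]
    ext
    simp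
  · simp [OpRep.pathImage, r]
  · change LinearMap.trace ℂ ℂ ((Pi.single i 1 : Q.V → Module.End ℂ ℂ) j) = _
    rcases eq_or_ne j i with rfl | hj
    · simp
    · simp [Pi.single_eq_of_ne hj]

theorem IsBrickRoot.exists_rigid_brick {d : Q.V → ℤ} (hd : Q.IsBrickRoot d) :
    ∃ M : ModuleCat.{0} Q.Preproj, Q.FinDim M ∧ Q.IsNilpotentMod M ∧ Q.IsBrick M ∧ Q.IsRigid M ∧
      Q.dimVec M = d := by
  obtain ⟨hdd, T, _, _, r, _, hb, hn, hd⟩ := hd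
  obtain ⟨M, φ, he, hx⟩ := r.compress.exists_moduleRep_equiv r.compress_unit
  have hfin : FiniteDimensional ℂ M := φ.finiteDimensional
  have hb' : (moduleRep M).IsBrick := hb.compress.of_equiv he hx
  have hd' : (moduleRep M).HasDim d := hd.compress.of_equiv he
  refine ⟨M, hfin, isNilpotentMod_of_isNil (hn.compress.of_equiv hx),
    isBrick_of_moduleRep hb' hd' ?_,
    isRigid_of_commutator fun θ hθ =>
      OpRep.exists_commutator_eq hb' hd' hdd (moduleRep_unit M) hθ, dimVec_eq hd'⟩
  rintro rfl
  simp [form] at hdd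

end LooplessQuiver

/-- If `Q` is a finite quiver without loops which is not of
Dynkin type, then there are infinitely many rigid bricks in the category
`P(Q)-nil` of finite-dimensional nilpotent `P(Q)`-modules: no finite list of
modules contains every rigid brick up to isomorphism. -/
theorem infinitely_many_rigid_bricks
    (Q : LooplessQuiver) (hQ : ¬ Q.IsDynkin) :
    ∀ (n : ℕ) (f : Fin n → ModuleCat.{0} Q.Preproj),
      ∃ M : ModuleCat.{0} Q.Preproj, Q.FinDim M ∧ Q.IsNilpotentMod M ∧
        Q.IsBrick M ∧ Q.IsRigid M ∧ ∀ i, ¬ Nonempty (M ≅ f i) := by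
  intro n f
  by_contra! hf
  refine hQ (LooplessQuiver.isDynkin_of_finite (D := {d | Q.IsBrickRoot d})
    ((Set.finite_range fun k => Q.dimVec (f k)).subset fun d hd => ?_)
    (fun d hd => LooplessQuiver.IsBrickRoot.nonneg hd) (fun d hd => hd.1) Q.isBrickRoot_single
    fun d hd i hdi => LooplessQuiver.IsBrickRoot.reflection hd hdi)
  obtain ⟨M, hfin, hn, hb, hr, rfl⟩ := LooplessQuiver.IsBrickRoot.exists_rigid_brick hd
  obtain ⟨k, ⟨φ⟩⟩ := hf M hfin hn hb hr
  exact ⟨k, (LooplessQuiver.dimVec_eq_of_iso φ).symm⟩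

end GreenSeqPaper
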